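/- arXiv:math/9810128 — 4 statements merged into one kernel-verified Lean document; each statement's English description precedes it below -/
import Mathlib

section
/- If the continuum X is a 2-to-1 retract of a continuum and K is a proper subcontinuum of X, then there is a connected component C of X \ K such that C ∪ K is a 2-to-1 retract of a continuum. -/
open Set Metric Topology

/-- A subcontinuum of a topological space: a nonempty compact connected subset. -/
def IsSubcontinuum {X : Type*} [TopologicalSpace X] (K : Set X) : Prop :=
  IsCompact K ∧ IsConnected K

/-- The metric space `Y` is an `m`-to-1 retract of a continuum: there is a continuum `X`,
a subcontinuum `Y'` of `X` homeomorphic to `Y`, and a continuous retraction of `X` onto `Y'`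
under which every point of `Y'` has exactly `m` preimages. -/
def IsMToOneRetract (m : ℕ) (Y : Type*) [MetricSpace Y] : Prop :=
  ∃ (X : Type) (_ : MetricSpace X), CompactSpace X ∧ ConnectedSpace X ∧ Nonempty X ∧
    ∃ Y' : Set X, IsSubcontinuum Y' ∧ Nonempty (Y ≃ₜ Y') ∧
      ∃ r : X → X, Continuous r ∧ (∀ x, r x ∈ Y') ∧ (∀ y ∈ Y', r y = y) ∧
        ∀ y ∈ Y', {x : X | r x = y}.ncard = m

/-- A 1-to-1 cover of a map `f` : a restriction of `f` to an open proper subset `U`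
of the domain such that `f` is injective on `U` and `f(U) = f(X)`. -/
def HasOneToOneCover {X Y : Type*} [TopologicalSpace X] (f : X → Y) : Prop :=
  ∃ U : Set X, IsOpen U ∧ U ≠ Set.univ ∧ Set.InjOn f U ∧ f '' U = Set.range f

/-- Strictly locally 1-to-1: locally injective but not injective. -/
def StrictlyLocallyInjective {X Y : Type*} [TopologicalSpace X] (f : X → Y) : Prop :=
  (∀ x : X, ∃ U ∈ 𝓝 x, Set.InjOn f U) ∧ ¬ Function.Injective f

/-- A map is simple if each point-inverse of a point of the image has cardinality one or two. -/
def SimpleMap {X Y : Type*} (f : X → Y) : Prop :=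
  ∀ y ∈ Set.range f, (f ⁻¹' {y}).ncard = 1 ∨ (f ⁻¹' {y}).ncard = 2

/-- `f` is injective on each proper subcontinuum of its domain. -/
def InjOnProperSubcontinua {X Y : Type*} [TopologicalSpace X] (f : X → Y) : Prop :=
  ∀ K : Set X, IsSubcontinuum K → K ≠ Set.univ → Set.InjOn f K

/-- Two sets are separated if neither contains a limit point of the other. -/
def SeparatedSets {X : Type*} [TopologicalSpace X] (A B : Set X) : Prop :=
  Disjoint (closure A) B ∧ Disjoint A (closure B)

/-- Every subcontinuum with more than one point is the union of two proper subcontinua. -/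
def HereditarilyDecomposable (X : Type*) [TopologicalSpace X] : Prop :=
  ∀ K : Set X, IsSubcontinuum K → K.Nontrivial →
    ∃ A B : Set X, IsSubcontinuum A ∧ IsSubcontinuum B ∧
      A ⊆ K ∧ B ⊆ K ∧ A ≠ K ∧ B ≠ K ∧ A ∪ B = K

/-- Arclike: for each `ε > 0` there is an `ε`-map onto `[0,1]`. -/
def Arclike (X : Type*) [MetricSpace X] : Prop :=
  ∀ ε > (0:ℝ), ∃ g : X → ℝ, Continuous g ∧ Set.range g = Set.Icc 0 1 ∧
    ∀ t : ℝ, Metric.diam (g ⁻¹' {t}) < ε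

/-- A tree: a connected finite graph (a continuum that is a finite union of arcs meeting
only at endpoints) containing no simple closed curve. -/
def IsTree (T : Type*) [MetricSpace T] : Prop :=
  CompactSpace T ∧ ConnectedSpace T ∧ Nonempty T ∧
    (∃ (n : ℕ) (γ : Fin n → ℝ → T),
      (∀ i, ContinuousOn (γ i) (Set.Icc 0 1) ∧ Set.InjOn (γ i) (Set.Icc 0 1)) ∧
      (⋃ i, γ i '' Set.Icc 0 1) = Set.univ ∧
      (∀ i j, i ≠ j →
        (γ i '' Set.Icc 0 1) ∩ (γ j '' Set.Icc 0 1) ⊆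
          ({γ i 0, γ i 1, γ j 0, γ j 1} : Set T))) ∧
    ¬ ∃ S : Set T, Nonempty (S ≃ₜ (Metric.sphere (0:ℂ) 1))

/-- Treelike: for each `ε > 0` there is an `ε`-map onto a tree. -/
def Treelike (X : Type*) [MetricSpace X] : Prop :=
  ∀ ε > (0:ℝ), ∃ (T : Type) (_ : MetricSpace T), IsTree T ∧
    ∃ g : X → T, Continuous g ∧ Function.Surjective g ∧
      ∀ t : T, Metric.diam (g ⁻¹' {t}) < ε

/-- `B` is a relatively clopen subset of `T`, phrased through closed sets of the ambient space
(so that `T` is closed as well). -/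
def IsClopenPart {S : Type*} [TopologicalSpace S] (B T : Set S) : Prop :=
  B ⊆ T ∧ IsClosed B ∧ IsClosed (T \ B)

theorem IsClopenPart.subset_of_isPreconnected {S : Type*} [TopologicalSpace S] {B T Q : Set S}
    (h : IsClopenPart B T) (hQ : IsPreconnected Q) (hQT : Q ⊆ T) (hne : (Q ∩ B).Nonempty) :
    Q ⊆ B := by
  intro x hx
  by_contra hxB
  obtain ⟨y, -, hy, hy'⟩ := isPreconnected_closed_iff.1 hQ B (T \ B) h.2.1 h.2.2
    (fun z hz => by by_cases hzB : z ∈ B <;> simp [hzB, hQT hz]) hne ⟨x, hx, hQT hx, hxB⟩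
  exact hy'.2 hy

theorem IsClopenPart.preimage {S Y : Type*} [TopologicalSpace S] [TopologicalSpace Y]
    {φ : S → Y} (hφ : Continuous φ) {B Q : Set Y} (h : IsClopenPart B Q) {T : Set S}
    (hT : IsClosed T) (hTQ : MapsTo φ T Q) : IsClopenPart (T ∩ φ ⁻¹' B) T := by
  refine ⟨inter_subset_left, hT.inter (h.2.1.preimage hφ), ?_⟩
  have : T \ (T ∩ φ ⁻¹' B) = T ∩ φ ⁻¹' (Q \ B) := by
    ext x
    have := @hTQ x
    simp only [mem_sdiff, mem_inter_iff, mem_preimage]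
    tauto
  rw [this]
  exact hT.inter (h.2.2.preimage hφ)

theorem IsClopenPart.mono {S : Type*} [TopologicalSpace S] {B T T' : Set S}
    (h : IsClopenPart B T) (hT' : IsClosed T') (hTT' : T' ⊆ T) : IsClopenPart (T' ∩ B) T' :=
  h.preimage continuous_id hT' hTT'

/-- The boundary bumping theorem. -/
theorem closure_connectedComponentIn_inter_compl_nonempty {S : Type*} [TopologicalSpace S]
    [CompactSpace S] [T2Space S] [ConnectedSpace S] {U : Set S} (hU : IsOpen U)
    (hne : U ≠ univ) {b : S} (hb : b ∈ U) :
    (closure (connectedComponentIn U b) ∩ Uᶜ).Nonempty := by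
  by_contra hcon
  have hQU : closure (connectedComponentIn U b) ⊆ U := by
    intro x hx
    by_contra hxU
    exact hcon ⟨x, hx, hxU⟩
  obtain ⟨V, hV, hQV, hVU⟩ := normal_exists_closure_subset isClosed_closure hU hQU
  have hbV : b ∈ V := hQV (subset_closure (mem_connectedComponentIn hb))
  have : CompactSpace (closure V) := isCompact_iff_compactSpace.1 isClosed_closure.isCompact
  let b' : closure V := ⟨b, subset_closure hbV⟩
  have : Nonempty {s : Set (closure V) // IsClopen s ∧ b' ∈ s} := ⟨⟨univ, isClopen_univ, trivial⟩⟩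
  obtain ⟨⟨s, hs, hbs⟩, hsV⟩ := exists_subset_nhds_of_compactSpace
    (V := fun s : {s : Set (closure V) // IsClopen s ∧ b' ∈ s} => s.1)
    (fun s t => ⟨⟨s.1 ∩ t.1, s.2.1.inter t.2.1, s.2.2, t.2.2⟩, inter_subset_left,
      inter_subset_right⟩) (fun s => s.2.1.isClosed) (U := Subtype.val ⁻¹' V) (by
      rw [← connectedComponent_eq_iInter_isClopen]
      intro x hx
      refine (hV.preimage continuous_subtype_val).mem_nhds (hQV (subset_closure ?_))
      have hpre : IsPreconnected (Subtype.val '' connectedComponent b') :=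
        isPreconnected_connectedComponent.image _ continuous_subtype_val.continuousOn
      refine hpre.subset_connectedComponentIn ⟨b', mem_connectedComponent, rfl⟩ ?_ ⟨x, hx, rfl⟩
      rintro _ ⟨y, -, rfl⟩
      exact hVU y.2)
  dsimp only at hsV
  have hclosed : IsClosed (Subtype.val '' s) :=
    isClosed_closure.isClosedEmbedding_subtypeVal.isClosedMap _ hs.isClosed
  have hopen : IsOpen (Subtype.val '' s) := by
    obtain ⟨O, hO, hOs⟩ := isOpen_induced_iff.1 hs.isOpen
    have : Subtype.val '' s = O ∩ V := by
      ext x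
      constructor
      · rintro ⟨y, hy, rfl⟩
        refine ⟨?_, hsV hy⟩
        rwa [← hOs] at hy
      · rintro ⟨hxO, hxV⟩
        refine ⟨⟨x, subset_closure hxV⟩, ?_, rfl⟩
        rw [← hOs]
        exact hxO
    rw [this]
    exact hO.inter hV
  have huniv := IsClopen.eq_univ ⟨hclosed, hopen⟩ ⟨b, b', hbs, rfl⟩
  apply hne
  rw [eq_univ_iff_forall]
  intro x
  have hx : x ∈ Subtype.val '' s := huniv ▸ mem_univ x
  obtain ⟨y, -, rfl⟩ := hx
  exact hVU y.2

theorem isClosed_connectedComponentIn_compl_union {X : Type*} [TopologicalSpace X] {K : Set X}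
    (hK : IsClosed K) {x : X} (hx : x ∈ Kᶜ) : IsClosed (connectedComponentIn Kᶜ x ∪ K) := by
  have hsub : closure (connectedComponentIn Kᶜ x) ⊆ connectedComponentIn Kᶜ x ∪ K := by
    intro y hy
    by_cases hyK : y ∈ K
    · exact Or.inr hyK
    · left
      have hpre : IsPreconnected (closure (connectedComponentIn Kᶜ x) ∩ Kᶜ) :=
        isPreconnected_connectedComponentIn.subset_closure
          (subset_inter subset_closure (connectedComponentIn_subset _ _)) inter_subset_left
      exact hpre.subset_connectedComponentIn ⟨subset_closure (mem_connectedComponentIn hx), hx⟩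
        inter_subset_right ⟨hy, hyK⟩
  refine isClosed_of_closure_subset ?_
  rw [closure_union, hK.closure_eq]
  exact union_subset hsub subset_union_right

theorem IsSubcontinuum.connectedComponentIn_compl_union {X : Type*} [TopologicalSpace X]
    [CompactSpace X] [T2Space X] [ConnectedSpace X] {K : Set X} (hK : IsSubcontinuum K)
    {x : X} (hx : x ∈ Kᶜ) : IsSubcontinuum (connectedComponentIn Kᶜ x ∪ K) := by
  have hclosed := isClosed_connectedComponentIn_compl_union hK.1.isClosed hx
  refine ⟨hclosed.isCompact, ?_⟩
  obtain ⟨z, hz, hzK⟩ := closure_connectedComponentIn_inter_compl_nonempty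
    hK.1.isClosed.isOpen_compl (by simpa using hK.2.nonempty.ne_empty) hx
  rw [compl_compl] at hzK
  have heq : connectedComponentIn Kᶜ x ∪ K = closure (connectedComponentIn Kᶜ x) ∪ K :=
    Subset.antisymm (union_subset_union_left _ subset_closure)
      (union_subset (closure_minimal subset_union_left hclosed) subset_union_right)
  rw [heq]
  exact IsConnected.union ⟨z, hz, hzK⟩
    (isConnected_connectedComponentIn_iff.2 hx).closure hK.2

/-- A continuum `M` is a 2-to-1 retract as soon as there is a compact set `Q` over `M` that has
exactly one point off the zero section `M × {o}` over each point of `M`, and no nonempty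
relatively clopen subset missing the zero section. -/
theorem isMToOneRetract_two_of_isCompact_prod {X G : Type} [MetricSpace X] [MetricSpace G]
    {M : Set X} (hM : IsSubcontinuum M) (o : G) {Q : Set (X × G)} (hQ : IsCompact Q)
    (hQM : ∀ q ∈ Q, q.1 ∈ M) (hu : ∀ m ∈ M, ∃! γ, γ ≠ o ∧ (m, γ) ∈ Q)
    (hB : ∀ B, IsClopenPart B Q → (∀ b ∈ B, b.2 ≠ o) → B = ∅) : IsMToOneRetract 2 M := by
  have hM0 : IsSubcontinuum (M ×ˢ ({o} : Set G)) :=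
    ⟨hM.1.prod isCompact_singleton, hM.2.prod isConnected_singleton⟩
  set Z : Set (X × G) := Q ∪ M ×ˢ {o}
  have hZc : IsCompact Z := hQ.union hM0.1
  have hMZ : ∀ m ∈ M, (m, o) ∈ Z := fun m hm => Or.inr ⟨hm, rfl⟩
  have hZM : ∀ z ∈ Z, z.1 ∈ M := by
    rintro z (hz | hz)
    exacts [hQM z hz, hz.1]
  obtain ⟨m₀, hm₀⟩ := hM.2.nonempty
  have hZconn : IsConnected Z := by
    refine ⟨⟨_, hMZ m₀ hm₀⟩, ?_⟩
    rw [isPreconnected_iff_subset_of_disjoint_closed]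
    have key : ∀ u v, IsClosed u → IsClosed v → Z ⊆ u ∪ v → Z ∩ (u ∩ v) = ∅ →
        M ×ˢ {o} ⊆ u → Z ⊆ u := by
      intro u v hu hv huv hd hMu
      have hempty := hB (Z ∩ v) ⟨?_, hZc.isClosed.inter hv, ?_⟩ ?_
      · intro z hz
        rcases huv hz with h | h
        · exact h
        · exact absurd (show z ∈ Z ∩ v from ⟨hz, h⟩) (by simp [hempty])
      · rintro z ⟨hz | hz, hzv⟩
        · exact hz
        · exact absurd (show z ∈ Z ∩ (u ∩ v) from ⟨Or.inr hz, hMu hz, hzv⟩) (by simp [hd])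
      · have : Q \ (Z ∩ v) = Q ∩ u := by
          ext z
          constructor
          · rintro ⟨hz, hzv⟩
            exact ⟨hz, (huv (Or.inl hz)).resolve_right fun h => hzv ⟨Or.inl hz, h⟩⟩
          · rintro ⟨hz, hzu⟩
            refine ⟨hz, fun h => ?_⟩
            exact absurd (show z ∈ Z ∩ (u ∩ v) from ⟨h.1, hzu, h.2⟩) (by simp [hd])
        rw [this]
        exact hQ.isClosed.inter hu
      · rintro z ⟨hz, hzv⟩ hzo
        exact absurd (show z ∈ Z ∩ (u ∩ v) from ⟨hz, hMu ⟨hZM z hz, hzo⟩, hzv⟩) (by simp [hd])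
    intro u v hu hv huv hd
    rcases isPreconnected_iff_subset_of_disjoint_closed.1 hM0.2.isPreconnected u v hu hv
      (subset_union_right.trans huv)
      (subset_empty_iff.1 ((inter_subset_inter_left _ subset_union_right).trans hd.subset))
      with h | h
    · exact Or.inl (key u v hu hv huv hd h)
    · exact Or.inr (key v u hv hu (by rwa [union_comm]) (by rwa [inter_comm v u]) h)
  let ι : M → Z := fun m => ⟨(m.1, o), hMZ m.1 m.2⟩
  have hι : Continuous ι := by fun_prop
  have hιinj : Function.Injective ι := by
    intro a b hab
    exact Subtype.ext (congrArg (fun z : Z => z.1.1) hab)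
  let p : Z → M := fun z => ⟨z.1.1, hZM z.1 z.2⟩
  have hp : Continuous p := by fun_prop
  have hpι : ∀ m, p (ι m) = m := fun m => rfl
  have hMc : CompactSpace M := isCompact_iff_compactSpace.1 hM.1
  have hMconn : ConnectedSpace M := isConnected_iff_connectedSpace.1 hM.2
  refine ⟨Z, inferInstance, isCompact_iff_compactSpace.1 hZc,
    isConnected_iff_connectedSpace.1 hZconn, ⟨ι ⟨m₀, hm₀⟩⟩, range ι,
    ⟨isCompact_range hι, isConnected_range hι⟩,
    ⟨(hι.isClosedEmbedding hιinj).isEmbedding.toHomeomorph⟩, ι ∘ p, hι.comp hp,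
    fun x => ⟨_, rfl⟩, ?_, ?_⟩
  · rintro _ ⟨m, rfl⟩
    rfl
  · rintro _ ⟨⟨m, hm⟩, rfl⟩
    obtain ⟨γ, ⟨hγo, hγQ⟩, huniq⟩ := hu m hm
    have : {x : Z | (ι ∘ p) x = ι ⟨m, hm⟩} = {ι ⟨m, hm⟩, ⟨(m, γ), Or.inl hγQ⟩} := by
      ext ⟨⟨a, g⟩, hz⟩
      simp only [Function.comp, mem_ofPred_eq, hιinj.eq_iff, mem_insert_iff, mem_singleton_iff]
      constructor
      · intro h
        have ham : a = m := congrArg Subtype.val h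
        subst ham
        by_cases hg : g = o
        · left
          subst hg
          rfl
        · right
          have := huniq g ⟨hg, hz.resolve_right fun h => hg h.2⟩
          subst this
          rfl
      · rintro (h | h)
        · rw [h]
        · rw [h]
    rw [this, ncard_pair]
    intro h
    exact hγo (congrArg (fun z : Z => z.1.2) h).symm

section OneToOneCover

variable {S X : Type*} [TopologicalSpace S] {f : S → X} {F : Set S} {K : Set X}

/-- Under a map `f` that is injective off `F`, a component of `Kᶜ` lifts to a subset off `F`
all of whose relatively clopen pieces reach `F` or the fibres over `K`. -/
theorem IsClopenPart.eq_empty_of_disjoint [CompactSpace S] [T2Space S] [ConnectedSpace S]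
    [TopologicalSpace X] (hf : Continuous f) (hF : IsClosed F)
    (hFne : F.Nonempty) (hK : IsClosed K) {x : X} {B : Set S}
    (hB : IsClopenPart B (f ⁻¹' (connectedComponentIn Kᶜ x ∪ K))) (hBF : Disjoint B F)
    (hBK : Disjoint B (f ⁻¹' K)) : B = ∅ := by
  rw [eq_empty_iff_forall_notMem]
  intro b hb
  set U : Set S := (F ∪ f ⁻¹' K)ᶜ with hU
  have hbF : b ∉ F := fun h => hBF.ne_of_mem hb h rfl
  have hbK : f b ∉ K := fun h => hBK.ne_of_mem hb (mem_preimage.2 h) rfl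
  have hbU : b ∈ U := by simp [hU, hbF, hbK]
  obtain ⟨y, hyF⟩ := hFne
  obtain ⟨z, hz, hzU⟩ := closure_connectedComponentIn_inter_compl_nonempty
    (hF.union (hK.preimage hf)).isOpen_compl
    (ne_univ_iff_exists_notMem _ |>.2 ⟨y, fun h => h (Or.inl hyF)⟩) hbU
  have hbC : f b ∈ connectedComponentIn Kᶜ x := (hB.1 hb).resolve_right hbK
  have himg : f '' connectedComponentIn U b ⊆ connectedComponentIn Kᶜ x := by
    rw [connectedComponentIn_eq hbC]
    refine (isPreconnected_connectedComponentIn.image f hf.continuousOn).subset_connectedComponentIn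
      ⟨b, mem_connectedComponentIn hbU, rfl⟩ ?_
    rintro _ ⟨t, ht, rfl⟩ htK
    exact connectedComponentIn_subset U b ht (Or.inr htK)
  have hQB : connectedComponentIn U b ⊆ B :=
    hB.subset_of_isPreconnected isPreconnected_connectedComponentIn
      (fun t ht => Or.inl (himg ⟨t, ht, rfl⟩)) ⟨b, mem_connectedComponentIn hbU, hb⟩
  have hzB : z ∈ B := closure_minimal hQB hB.2.1 hz
  rw [compl_compl] at hzU
  rcases hzU with h | h
  · exact hBF.ne_of_mem hzB h rfl
  · exact hBK.ne_of_mem hzB h rfl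

/-- `E`, a subset of the fibres over `K`, extends without meeting further fibres over `K` to a
relatively clopen subset of the fibres over `L` that misses `F`. -/
def HasClopenExtension (f : S → X) (F E : Set S) (K L : Set X) : Prop :=
  ∃ P, IsClopenPart P (f ⁻¹' L) ∧ Disjoint P F ∧ f ⁻¹' K ∩ P = E

theorem HasClopenExtension.mono [TopologicalSpace X] {E : Set S} {L L' : Set X} (hf : Continuous f)
    (h : HasClopenExtension f F E K L) (hL' : IsClosed L') (hKL' : K ⊆ L') (hLL' : L' ⊆ L) :
    HasClopenExtension f F E K L' := by
  obtain ⟨P, hP, hPF, hPK⟩ := h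
  refine ⟨f ⁻¹' L' ∩ P, hP.mono (hL'.preimage hf) (preimage_mono hLL'),
    hPF.mono_left inter_subset_right, ?_⟩
  rw [← inter_assoc, ← preimage_inter, inter_eq_left.2 hKL', hPK]

theorem HasClopenExtension.union {E : Set S} {L₁ L₂ : Set X}
    (h₁ : HasClopenExtension f F E K L₁) (h₂ : HasClopenExtension f F E K L₂)
    (hL : L₁ ∩ L₂ ⊆ K) : HasClopenExtension f F E K (L₁ ∪ L₂) := by
  obtain ⟨P₁, hP₁, hPF₁, hPK₁⟩ := h₁
  obtain ⟨P₂, hP₂, hPF₂, hPK₂⟩ := h₂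
  refine ⟨P₁ ∪ P₂, ⟨union_subset_union hP₁.1 hP₂.1, hP₁.2.1.union hP₂.2.1, ?_⟩,
    hPF₁.union_left hPF₂, by rw [inter_union_distrib_left, hPK₁, hPK₂, union_self]⟩
  have hcross : ∀ s, f s ∈ L₁ → f s ∈ L₂ → (s ∈ P₁ ↔ s ∈ P₂) := by
    intro s hs₁ hs₂
    have hsK : s ∈ f ⁻¹' K := hL ⟨hs₁, hs₂⟩
    have := Set.ext_iff.1 (hPK₁.trans hPK₂.symm) s
    simpa [hsK] using this
  have : f ⁻¹' (L₁ ∪ L₂) \ (P₁ ∪ P₂) = (f ⁻¹' L₁ \ P₁) ∪ (f ⁻¹' L₂ \ P₂) := by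
    ext s
    have h₁ := @hP₁.1 s
    have h₂ := @hP₂.1 s
    have := hcross s
    simp only [mem_sdiff, mem_union, mem_preimage] at *
    tauto
  rw [this]
  exact hP₁.2.2.union hP₂.2.2

theorem HasClopenExtension.exists_of_sInter [CompactSpace S] [T2Space S] [TopologicalSpace X]
    {E : Set S} (hf : Continuous f) (hF : IsClosed F)
    {c : Set (Set X)} (hc : IsChain (· ⊆ ·) c) (hne : c.Nonempty)
    (hclosed : ∀ L ∈ c, IsClosed L) (hKc : ∀ L ∈ c, K ⊆ L)
    (h : HasClopenExtension f F E K (⋂₀ c)) : ∃ L ∈ c, HasClopenExtension f F E K L := by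
  obtain ⟨P, hP, hPF, hPK⟩ := h
  obtain ⟨V, V', hV, hV', hPV, hRV', hVV'⟩ := normal_separation
    hP.2.1 (hP.2.2.union hF) (disjoint_sdiff_self_right.union_right hPF)
  have : Nonempty c := hne.to_subtype
  obtain ⟨⟨L, hL⟩, hLV⟩ := exists_subset_nhds_of_compactSpace (V := fun L : c => f ⁻¹' L.1)
    (U := V ∪ V') (by
      intro a b
      rcases hc.total a.2 b.2 with h | h
      · exact ⟨a, Subset.rfl, preimage_mono h⟩
      · exact ⟨b, preimage_mono h, Subset.rfl⟩)
    (fun L => (hclosed L.1 L.2).preimage hf) (by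
      intro s hs
      refine (hV.union hV').mem_nhds ?_
      have hs' : s ∈ f ⁻¹' ⋂₀ c := by simpa using hs
      by_cases hsP : s ∈ P
      · exact Or.inl (hPV hsP)
      · exact Or.inr (hRV' (Or.inl ⟨hs', hsP⟩)))
  have hfL : IsClosed (f ⁻¹' L) := (hclosed L hL).preimage hf
  have hVnot : ∀ s, s ∈ V → s ∉ V' := fun s hs hs' => hVV'.ne_of_mem hs hs' rfl
  have hdich : ∀ s, f s ∈ L → (s ∉ V' ↔ s ∈ V) := by
    intro s hs
    have := hVnot s
    have := hLV (show s ∈ f ⁻¹' L from hs)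
    simp only [mem_union] at this
    tauto
  refine ⟨L, hL, f ⁻¹' L ∩ V, ⟨inter_subset_left, ?_, ?_⟩, ?_, ?_⟩
  · have : f ⁻¹' L ∩ V = f ⁻¹' L ∩ V'ᶜ := by
      ext s
      simp only [mem_inter_iff, mem_preimage, mem_compl_iff]
      exact and_congr_right fun h => (hdich s h).symm
    rw [this]
    exact hfL.inter hV'.isClosed_compl
  · rw [sdiff_self_inter]
    exact hfL.sdiff hV
  · exact hVV'.mono inter_subset_right (subset_union_right.trans hRV')
  · rw [← hPK]
    ext s
    simp only [mem_inter_iff, mem_preimage]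
    constructor
    · rintro ⟨hsK, -, hsV⟩
      refine ⟨hsK, by_contra fun hsP => hVnot s hsV (hRV' (Or.inl ⟨?_, hsP⟩))⟩
      exact fun L hL => hKc L hL hsK
    · rintro ⟨hsK, hsP⟩
      exact ⟨hsK, hKc L hL hsK, hPV hsP⟩

/-- By Brouwer reduction, a clopen part of the fibres over `K` that misses `F` fails to extend
over some component of `Kᶜ`. -/
theorem exists_not_hasClopenExtension [CompactSpace S] [T2Space S] [ConnectedSpace S]
    [TopologicalSpace X] (hf : Continuous f) (hF : IsClosed F)
    (hFne : F.Nonempty) (hK : IsClosed K) {E : Set S} (hE : IsClopenPart E (f ⁻¹' K))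
    (hEF : Disjoint E F) (hEne : E.Nonempty) :
    ∃ x ∈ Kᶜ, ¬ HasClopenExtension f F E K (connectedComponentIn Kᶜ x ∪ K) := by
  have huniv : ¬ HasClopenExtension f F E K univ := by
    rintro ⟨P, hP, hPF, hPK⟩
    have hPopen : IsOpen P := by
      have := hP.2.2
      rwa [preimage_univ, ← compl_eq_univ_sdiff, isClosed_compl_iff] at this
    have hPE : E ⊆ P := hPK ▸ inter_subset_right
    have := IsClopen.eq_univ ⟨hP.2.1, hPopen⟩ (hEne.mono hPE)
    rw [this, univ_disjoint] at hPF
    exact hFne.ne_empty hPF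
  obtain ⟨L, -, ⟨hL, hKL, hLE⟩, hmin⟩ := zorn_superset_nonempty
    {L : Set X | IsClosed L ∧ K ⊆ L ∧ ¬ HasClopenExtension f F E K L} (by
      intro c hcS hc hne
      refine ⟨⋂₀ c, ⟨isClosed_sInter fun L hL => (hcS hL).1,
        subset_sInter fun L hL => (hcS hL).2.1, fun h => ?_⟩, fun L hL => sInter_subset_of_mem hL⟩
      obtain ⟨L, hL, hLE⟩ := h.exists_of_sInter hf hF hc hne (fun L hL => (hcS hL).1)
        (fun L hL => (hcS hL).2.1)
      exact (hcS hL).2.2 hLE) univ ⟨isClosed_univ, subset_univ _, huniv⟩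
  have hproper : ∀ L', IsClosed L' → K ⊆ L' → L' ⊆ L → ¬ L ⊆ L' →
      HasClopenExtension f F E K L' := fun L' h₁ h₂ h₃ h₄ =>
    by_contra fun h => h₄ (hmin ⟨h₁, h₂, h⟩ h₃)
  have hpre : IsPreconnected (L \ K) := by
    intro u v hu hv huv ⟨a, ha, hau⟩ ⟨b, hb, hbv⟩
    by_contra hd
    have hduv : ∀ z ∈ L \ K, z ∈ u → z ∉ v := fun z hz hzu hzv => hd ⟨z, hz, hzu, hzv⟩
    have h₁ := hproper (K ∪ L \ u) (hK.union (hL.sdiff hu)) subset_union_left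
      (union_subset hKL sdiff_subset) (fun h => (h ha.1).elim ha.2 fun h => h.2 hau)
    have h₂ := hproper (K ∪ L \ v) (hK.union (hL.sdiff hv)) subset_union_left
      (union_subset hKL sdiff_subset) (fun h => (h hb.1).elim hb.2 fun h => h.2 hbv)
    have h₁₂ := h₁.union h₂ (by
      rintro z ⟨h | h, h' | h'⟩
      · exact h
      · exact h
      · exact h'
      · by_contra hzK
        exact (huv ⟨h.1, hzK⟩).elim h.2 h'.2)
    refine hLE (h₁₂.mono hf hL hKL ?_)
    intro z hz
    by_cases hzK : z ∈ K
    · exact Or.inl (Or.inl hzK)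
    · by_cases hzu : z ∈ u
      · exact Or.inr (Or.inr ⟨hz, hduv z ⟨hz, hzK⟩ hzu⟩)
      · exact Or.inl (Or.inr ⟨hz, hzu⟩)
  have hLK : (L \ K).Nonempty := by
    rw [nonempty_iff_ne_empty, Ne, sdiff_eq_empty]
    intro h
    refine hLE ⟨E, ?_, hEF, inter_eq_right.2 hE.1⟩
    rwa [Subset.antisymm h hKL]
  obtain ⟨x, hx⟩ := hLK
  refine ⟨x, hx.2, fun h => hLE (h.mono hf hL hKL ?_)⟩
  intro z hz
  by_cases hzK : z ∈ K
  · exact Or.inr hzK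
  · exact Or.inl (hpre.subset_connectedComponentIn hx (fun y hy => hy.2) ⟨hz, hzK⟩)

end OneToOneCover

theorem IsMToOneRetract.exists_oneToOneCover {X : Type*} [MetricSpace X]
    (hX : IsMToOneRetract 2 X) :
    ∃ (S : Type) (_ : MetricSpace S) (f : S → X) (F : Set S), CompactSpace S ∧
      ConnectedSpace S ∧ Continuous f ∧ IsClosed F ∧ F.Nonempty ∧ ∀ x, ∃! s, s ∉ F ∧ f s = x := by
  obtain ⟨S, _, hSc, hSconn, -, Y, hY, ⟨e⟩, r, hr, hrY, hrid, hcard⟩ := hX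
  refine ⟨S, inferInstance, fun s => e.symm ⟨r s, hrY s⟩, Y, hSc, hSconn, by fun_prop,
    hY.1.isClosed, hY.2.nonempty, fun x => ?_⟩
  have hfib : ∀ s, e.symm ⟨r s, hrY s⟩ = x ↔ r s = e x := by
    intro s
    rw [e.symm_apply_eq, Subtype.ext_iff]
  simp only [hfib]
  obtain ⟨a, b, hab, hset⟩ := ncard_eq_two.1 (hcard (e x) (e x).2)
  have hmem : ∀ s, r s = e x ↔ s = a ∨ s = b := fun s => by
    have := Set.ext_iff.1 hset s
    simpa using this
  have hyy : ∀ s ∈ Y, r s = e x → s = e x := fun s hs h => (hrid s hs).symm.trans h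
  rcases (hmem (e x)).1 (hrid _ (e x).2) with h | h
  · refine ⟨b, ⟨fun hbY => hab ?_, (hmem b).2 (Or.inr rfl)⟩, ?_⟩
    · rw [← h, hyy b hbY ((hmem b).2 (Or.inr rfl))]
    · rintro s ⟨hsY, hs⟩
      exact ((hmem s).1 hs).resolve_left fun hsa => hsY (by rw [hsa, ← h]; exact (e x).2)
  · refine ⟨a, ⟨fun haY => hab ?_, (hmem a).2 (Or.inl rfl)⟩, ?_⟩
    · rw [← h, hyy a haY ((hmem a).2 (Or.inl rfl))]
    · rintro s ⟨hsY, hs⟩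
      exact ((hmem s).1 hs).resolve_right fun hsa => hsY (by rw [hsa, ← h]; exact (e x).2)

section Retract

variable {S X : Type} [MetricSpace S] [CompactSpace S] [ConnectedSpace S] [MetricSpace X]
  [CompactSpace X] [ConnectedSpace X] {f : S → X} {F : Set S} {K : Set X}

theorem isMToOneRetract_two_of_forall_isClopenPart_eq_empty (hf : Continuous f)
    (hF : IsClosed F) (hFne : F.Nonempty) (hcover : ∀ x, ∃! s, s ∉ F ∧ f s = x)
    (hK : IsSubcontinuum K) {x : X} (hx : x ∈ Kᶜ)
    (h : ∀ E, IsClopenPart E (f ⁻¹' K) → Disjoint E F → E = ∅) :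
    IsMToOneRetract 2 ↥(connectedComponentIn Kᶜ x ∪ K) := by
  have hM := hK.connectedComponentIn_compl_union hx
  set M := connectedComponentIn Kᶜ x ∪ K
  have hfK : IsClosed (f ⁻¹' K) := hK.1.isClosed.preimage hf
  have hfM : IsClosed (f ⁻¹' M) := hM.1.isClosed.preimage hf
  have hA : IsClosed (F ∪ f ⁻¹' K) := hF.union hfK
  have hdA : ∀ s, infDist s (F ∪ f ⁻¹' K) = 0 ↔ s ∈ F ∪ f ⁻¹' K := fun s =>
    (hA.mem_iff_infDist_zero hFne.inl).symm
  have hdF : ∀ s, infDist s F = 0 ↔ s ∈ F := fun s => (hF.mem_iff_infDist_zero hFne).symm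
  let φ : S → X × (ℝ × ℝ) := fun s => (f s, infDist s (F ∪ f ⁻¹' K), 0)
  let ψ : S → X × (ℝ × ℝ) := fun s => (f s, 0, infDist s F)
  have hφ : Continuous φ :=
    hf.prodMk ((continuous_infDist_pt _).prodMk continuous_const)
  have hψ : Continuous ψ :=
    hf.prodMk (continuous_const.prodMk (continuous_infDist_pt _))
  refine isMToOneRetract_two_of_isCompact_prod hM (0 : ℝ × ℝ)
    (Q := φ '' (f ⁻¹' M) ∪ ψ '' (f ⁻¹' K))
    ((hfM.isCompact.image hφ).union (hfK.isCompact.image hψ)) ?_ ?_ ?_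
  · rintro _ (⟨s, hs, rfl⟩ | ⟨s, hs, rfl⟩)
    exacts [hs, Or.inr hs]
  · intro m hm
    obtain ⟨s, ⟨hsF, rfl⟩, huniq⟩ := hcover m
    by_cases hsK : f s ∈ K
    · refine ⟨(0, infDist s F), ⟨?_, Or.inr ⟨s, hsK, rfl⟩⟩, ?_⟩
      · simpa [hdF] using hsF
      · rintro γ ⟨hγ, ⟨t, ht, hts⟩ | ⟨t, ht, hts⟩⟩
        · obtain ⟨hft, rfl⟩ := Prod.mk.inj hts
          refine absurd ?_ hγ
          rw [(hdA t).2 (Or.inr (show f t ∈ K from hft ▸ hsK))]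
          rfl
        · obtain ⟨hft, rfl⟩ := Prod.mk.inj hts
          have htF : t ∉ F := fun htF => hγ (by rw [(hdF t).2 htF]; rfl)
          rw [huniq t ⟨htF, hft⟩]
    · refine ⟨(infDist s (F ∪ f ⁻¹' K), 0), ⟨?_, Or.inl ⟨s, hm, rfl⟩⟩, ?_⟩
      · simp [hdA, hsF, hsK]
      · rintro γ ⟨hγ, ⟨t, ht, hts⟩ | ⟨t, ht, hts⟩⟩
        · obtain ⟨hft, rfl⟩ := Prod.mk.inj hts
          have htF : t ∉ F := fun htF => hγ (by rw [(hdA t).2 (Or.inl htF)]; rfl)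
          rw [huniq t ⟨htF, hft⟩]
        · exact absurd ((Prod.mk.inj hts).1 ▸ ht : f s ∈ K) hsK
  · intro B hB hBo
    have h₁ := (hB.preimage hφ hfM (fun s hs => Or.inl ⟨s, hs, rfl⟩)).eq_empty_of_disjoint hf hF
      hFne hK.1.isClosed
      (disjoint_left.2 fun s hs hsF => hBo _ hs.2 (Prod.ext ((hdA s).2 (Or.inl hsF)) rfl))
      (disjoint_left.2 fun s hs hsK => hBo _ hs.2 (Prod.ext ((hdA s).2 (Or.inr hsK)) rfl))
    have h₂ := h _ (hB.preimage hψ hfK (fun s hs => Or.inr ⟨s, hs, rfl⟩))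
      (disjoint_left.2 fun s hs hsF => hBo _ hs.2 (Prod.ext rfl ((hdF s).2 hsF)))
    rw [eq_empty_iff_forall_notMem] at h₁ h₂ ⊢
    intro b hb
    rcases hB.1 hb with ⟨s, hs, rfl⟩ | ⟨s, hs, rfl⟩
    exacts [h₁ s ⟨hs, hb⟩, h₂ s ⟨hs, hb⟩]

theorem isMToOneRetract_two_of_not_hasClopenExtension (hf : Continuous f)
    (hF : IsClosed F) (hFne : F.Nonempty) (hcover : ∀ x, ∃! s, s ∉ F ∧ f s = x)
    (hK : IsSubcontinuum K) {x : X} (hx : x ∈ Kᶜ) {E : Set S} (hE : IsClopenPart E (f ⁻¹' K))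
    (hEF : Disjoint E F)
    (h : ¬ HasClopenExtension f F E K (connectedComponentIn Kᶜ x ∪ K)) :
    IsMToOneRetract 2 ↥(connectedComponentIn Kᶜ x ∪ K) := by
  have hM := hK.connectedComponentIn_compl_union hx
  set M := connectedComponentIn Kᶜ x ∪ K
  have hfK : IsClosed (f ⁻¹' K) := hK.1.isClosed.preimage hf
  have hfM : IsClosed (f ⁻¹' M) := hM.1.isClosed.preimage hf
  have hA : IsClosed (F ∪ f ⁻¹' K) := hF.union hfK
  have hdA : ∀ s, infDist s (F ∪ f ⁻¹' K) = 0 ↔ s ∈ F ∪ f ⁻¹' K := fun s =>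
    (hA.mem_iff_infDist_zero hFne.inl).symm
  obtain ⟨u, hu₀, hu₁, -⟩ := exists_continuous_zero_one_of_isClosed (hF.union hE.2.2) hE.2.1
    (hEF.symm.union_left disjoint_sdiff_self_left)
  have huF : ∀ s ∈ F, u s = 0 := fun s hs => hu₀ (Or.inl hs)
  have huK : ∀ s, f s ∈ K → s ∉ E → u s = 0 := fun s hs hsE => hu₀ (Or.inr ⟨hs, hsE⟩)
  have huE : ∀ s ∈ E, u s = 1 := fun s hs => hu₁ hs
  have hEK : ∀ s ∈ E, f s ∈ K := fun s hs => hE.1 hs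
  let φ : S → X × (ℝ × ℝ) := fun s => (f s, infDist s (F ∪ f ⁻¹' K), u s)
  have hφ : Continuous φ := hf.prodMk ((continuous_infDist_pt _).prodMk u.continuous)
  have hφF : ∀ s ∈ F, (φ s).2 = 0 := fun s hs => Prod.ext ((hdA s).2 (Or.inl hs)) (huF s hs)
  have hφK : ∀ s, f s ∈ K → s ∉ E → (φ s).2 = 0 := fun s hs hsE =>
    Prod.ext ((hdA s).2 (Or.inr hs)) (huK s hs hsE)
  have hφE : ∀ s ∈ E, (φ s).2 = (0, 1) := fun s hs =>
    Prod.ext ((hdA s).2 (Or.inr (hEK s hs))) (huE s hs)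
  refine isMToOneRetract_two_of_isCompact_prod hM (0 : ℝ × ℝ)
    (Q := φ '' (f ⁻¹' M) ∪ K ×ˢ {(0, 1)})
    ((hfM.isCompact.image hφ).union (hK.1.prod isCompact_singleton)) ?_ ?_ ?_
  · rintro _ (⟨s, hs, rfl⟩ | hq)
    exacts [hs, Or.inr hq.1]
  · intro m hm
    by_cases hmK : m ∈ K
    · refine ⟨(0, 1), ⟨by simp, Or.inr ⟨hmK, rfl⟩⟩, ?_⟩
      rintro γ ⟨hγ, ⟨t, ht, hts⟩ | ht⟩
      · obtain ⟨rfl, rfl⟩ := Prod.mk.inj hts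
        exact hφE t (by_contra fun htE => hγ (hφK t hmK htE))
      · exact ht.2
    · obtain ⟨s, ⟨hsF, rfl⟩, huniq⟩ := hcover m
      refine ⟨(φ s).2, ⟨fun h0 => ?_, Or.inl ⟨s, hm, rfl⟩⟩, ?_⟩
      · exact ((hdA s).1 (congrArg Prod.fst h0)).elim hsF hmK
      · rintro γ ⟨hγ, ⟨t, ht, hts⟩ | ht⟩
        · obtain ⟨hft, rfl⟩ := Prod.mk.inj hts
          rw [huniq t ⟨fun htF => hγ (hφF t htF), hft⟩]
        · exact absurd ht.1 hmK
  · intro B hB hBo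
    have hB₁ := hB.preimage hφ hfM (fun s hs => Or.inl ⟨s, hs, rfl⟩)
    have hB₁F : Disjoint (f ⁻¹' M ∩ φ ⁻¹' B) F :=
      disjoint_left.2 fun s hs hsF => hBo _ hs.2 (hφF s hsF)
    have hdisj : ∀ k ∈ K, (k, ((0 : ℝ), (1 : ℝ))) ∉ B := by
      intro k hk hkB
      have hsub : K ×ˢ {((0 : ℝ), (1 : ℝ))} ⊆ B := hB.subset_of_isPreconnected
        (hK.2.isPreconnected.prod isPreconnected_singleton) subset_union_right
        ⟨_, ⟨hk, mem_singleton _⟩, hkB⟩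
      refine h ⟨_, hB₁, hB₁F, ?_⟩
      ext s
      constructor
      · rintro ⟨hsK, -, hsB⟩
        exact by_contra fun hsE => hBo _ hsB (hφK s hsK hsE)
      · intro hsE
        exact ⟨hEK s hsE, Or.inr (hEK s hsE), hsub ⟨hEK s hsE, hφE s hsE⟩⟩
    have h₁ := hB₁.eq_empty_of_disjoint hf hF hFne hK.1.isClosed hB₁F
      (disjoint_left.2 fun s hs hsK => by
        by_cases hsE : s ∈ E
        · refine hdisj (f s) hsK ?_
          rw [← hφE s hsE]
          exact hs.2
        · exact hBo _ hs.2 (hφK s hsK hsE))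
    rw [eq_empty_iff_forall_notMem] at h₁ ⊢
    rintro ⟨k, γ⟩ hb
    rcases hB.1 hb with ⟨s, hs, hsb⟩ | ⟨hk, hγ⟩
    · exact h₁ s ⟨hs, show φ s ∈ B from hsb ▸ hb⟩
    · obtain rfl : γ = (0, 1) := hγ
      exact hdisj k hk hb

end Retract

/-- If the continuum `X` is a 2-to-1 retract and `K` is a proper subcontinuum of `X`,
then there is a connected component `C` of `X \ K` such that `C ∪ K` is a 2-to-1
retract of a continuum. -/
theorem exists_component_union_subcontinuum_retract
    (X : Type) [MetricSpace X] [CompactSpace X] [ConnectedSpace X] [Nonempty X]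
    (hX : IsMToOneRetract 2 X)
    (K : Set X) (hK : IsSubcontinuum K) (hKprop : K ≠ Set.univ) :
    ∃ x ∈ Kᶜ, IsMToOneRetract 2 ↥(connectedComponentIn Kᶜ x ∪ K) := by
  obtain ⟨S, _, f, F, _, _, hf, hF, hFne, hcover⟩ := hX.exists_oneToOneCover
  by_cases h : ∀ E, IsClopenPart E (f ⁻¹' K) → Disjoint E F → E = ∅
  · obtain ⟨x, hx⟩ := nonempty_compl.2 hKprop
    exact ⟨x, hx, isMToOneRetract_two_of_forall_isClopenPart_eq_empty hf hF hFne hcover hK hx h⟩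
  · push Not at h
    obtain ⟨E, hE, hEF, hEne⟩ := h
    obtain ⟨x, hx, hxE⟩ := exists_not_hasClopenExtension hf hF hFne hK.1.isClosed hE hEF
      hEne
    exact ⟨x, hx, isMToOneRetract_two_of_not_hasClopenExtension hf hF hFne hcover hK hx hE hEF hxE⟩
end

section
/- Suppose X is a continuum and X = A ∪ B where A and B are proper subcontinua of X. Then X is a 2-to-1 retract of a continuum if and only if at least one of the following holds: A is a 2-to-1 retract of a continuum, or B is a 2-to-1 retract of a continuum, or A ∩ B is not connected. -/
open Set Metric Topology

/-- The zero section over `S` together with the graph of `f` over `S`. -/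
def doubleGraph {X : Type*} (S : Set X) (f : X → ℝ) : Set (X × ℝ) :=
  (fun x => (x, (0 : ℝ))) '' S ∪ (fun x => (x, f x)) '' S

/-- Some nowhere vanishing function on `S` has a graph whose union with the zero section over `S`
is a continuum. -/
def HasContinuumDoubleGraph {X : Type*} [TopologicalSpace X] (S : Set X) : Prop :=
  ∃ f : X → ℝ, (∀ x ∈ S, f x ≠ 0) ∧ IsCompact (doubleGraph S f) ∧
    IsPreconnected (doubleGraph S f)

lemma mem_doubleGraph {X : Type*} {S : Set X} {f : X → ℝ} {p : X × ℝ} :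
    p ∈ doubleGraph S f ↔ p.1 ∈ S ∧ (p.2 = 0 ∨ p.2 = f p.1) := by
  obtain ⟨x, t⟩ := p
  simp only [doubleGraph, mem_union, mem_image, Prod.mk.injEq]
  constructor
  · rintro (⟨y, hy, rfl, rfl⟩ | ⟨y, hy, rfl, rfl⟩) <;> simp [hy]
  · rintro ⟨hx, rfl | rfl⟩
    · exact Or.inl ⟨x, hx, rfl, rfl⟩
    · exact Or.inr ⟨x, hx, rfl, rfl⟩

lemma HasContinuumDoubleGraph.of_isMToOneRetract {Y X : Type*} [MetricSpace Y] [MetricSpace X]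
    {e : Y → X} (he : IsClosedEmbedding e) (h : IsMToOneRetract 2 Y) :
    HasContinuumDoubleGraph (range e) := by
  obtain ⟨Z, _, _, _, _, Y', hY', ⟨h⟩, r, hr, hrY, hrid, hcard⟩ := h
  have hfib : ∀ y : Y', ∃ z, z ∉ Y' ∧ {x | r x = y} = {(y : Z), z} := by
    intro y
    obtain ⟨a, b, hab, hS⟩ := Set.ncard_eq_two.1 (hcard y y.2)
    have hy : (y : Z) ∈ ({a, b} : Set Z) := hS ▸ hrid y y.2
    have key : ∀ z, z ≠ (y : Z) → z ∈ ({a, b} : Set Z) → z ∉ Y' := by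
      intro z hz hz' hzY
      rw [← hS] at hz'
      exact hz ((hrid z hzY).symm.trans hz')
    rcases hy with hy | hy
    · refine ⟨b, key b (by rw [hy]; exact hab.symm) (by simp), by rw [hS, hy]⟩
    · rw [mem_singleton_iff] at hy
      refine ⟨a, key a (by rw [hy]; exact hab) (by simp), by rw [hS, hy, Set.pair_comm]⟩
  choose w hwY hw using hfib
  have hrw : ∀ y, r (w y) = y := fun y => by
    have : w y ∈ {x | r x = y} := by rw [hw]; simp
    exact this
  have hcl : IsClosed Y' := hY'.1.isClosed
  let f : X → ℝ := Function.extend e (fun y => infDist (w (h y)) Y') 1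
  have hf : ∀ y, f (e y) = infDist (w (h y)) Y' := fun y => he.injective.extend_apply _ _ _
  let φ : Z → X × ℝ := fun z => (e (h.symm ⟨r z, hrY z⟩), infDist z Y')
  have hφ : Continuous φ :=
    (he.continuous.comp (h.symm.continuous.comp (hr.subtype_mk _))).prodMk (continuous_infDist_pt _)
  have hφr : range φ = doubleGraph (range e) f := by
    ext p
    rw [mem_doubleGraph]
    constructor
    · rintro ⟨z, rfl⟩
      refine ⟨⟨_, rfl⟩, ?_⟩
      have hz : z ∈ {x | r x = (⟨r z, hrY z⟩ : Y')} := rfl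
      rw [hw] at hz
      rcases hz with hz | hz
      · left
        have : z ∈ Y' := by rw [hz]; exact hrY z
        exact infDist_zero_of_mem this
      · right
        simp only [φ, hf, h.apply_symm_apply]
        rw [← mem_singleton_iff.1 hz]
    · obtain ⟨x, t⟩ := p
      simp only
      rintro ⟨⟨y, rfl⟩, rfl | rfl⟩
      · refine ⟨h y, Prod.ext ?_ (infDist_zero_of_mem (h y).2)⟩
        simp [φ, hrid _ (h y).2]
      · refine ⟨w (h y), Prod.ext ?_ (hf y).symm⟩
        simp [φ, hrw]
  refine ⟨f, ?_, hφr ▸ isCompact_range hφ, hφr ▸ isPreconnected_range hφ⟩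
  rintro _ ⟨y, rfl⟩
  rw [hf]
  exact ((hcl.notMem_iff_infDist_pos hY'.2.nonempty).1 (hwY _)).ne'

lemma HasContinuumDoubleGraph.isMToOneRetract {Y X : Type} [MetricSpace Y] [MetricSpace X]
    {e : Y → X} (he : IsClosedEmbedding e) (hS : IsSubcontinuum (range e))
    (h : HasContinuumDoubleGraph (range e)) : IsMToOneRetract 2 Y := by
  obtain ⟨f, hf, hc, hp⟩ := h
  have hYc : CompactSpace Y := ⟨by
    rw [he.isEmbedding.isCompact_iff, image_univ]; exact hS.1⟩
  have hYn : Nonempty Y := range_nonempty_iff_nonempty.1 hS.2.nonempty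
  have hYp : PreconnectedSpace Y := ⟨by
    rw [← he.isInducing.isPreconnected_image, image_univ]; exact hS.2.isPreconnected⟩
  let Z := ↥(doubleGraph (range e) f)
  let j : Y → Z := fun y => ⟨(e y, 0), mem_doubleGraph.2 ⟨⟨y, rfl⟩, Or.inl rfl⟩⟩
  have hj : Continuous j := (he.continuous.prodMk continuous_const).subtype_mk _
  have hji : Function.Injective j := fun a b hab =>
    he.injective (congrArg (fun z : Z => z.1.1) hab)
  have : CompactSpace Z := isCompact_iff_compactSpace.1 hc
  have hZn : Nonempty Z := hYn.map j
  have : PreconnectedSpace Z := isPreconnected_iff_preconnectedSpace.1 hp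
  let r : Z → Z := fun z =>
    ⟨(z.1.1, 0), mem_doubleGraph.2 ⟨(mem_doubleGraph.1 z.2).1, Or.inl rfl⟩⟩
  have hr : Continuous r :=
    ((continuous_fst.comp continuous_subtype_val).prodMk continuous_const).subtype_mk _
  refine ⟨Z, inferInstance, inferInstance, ⟨hZn⟩, hZn, range j,
    ⟨isCompact_range hj, range_nonempty j, isPreconnected_range hj⟩,
    ⟨(hj.isClosedEmbedding hji).isEmbedding.toHomeomorph⟩, r, hr, ?_, ?_, ?_⟩
  · intro z
    obtain ⟨y, hy⟩ := (mem_doubleGraph.1 z.2).1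
    exact ⟨y, Subtype.ext (Prod.ext hy rfl)⟩
  · rintro _ ⟨y, rfl⟩
    rfl
  · rintro _ ⟨y, rfl⟩
    have hk : (e y, f (e y)) ∈ doubleGraph (range e) f :=
      mem_doubleGraph.2 ⟨⟨y, rfl⟩, Or.inr rfl⟩
    rw [Set.ncard_eq_two]
    refine ⟨j y, ⟨_, hk⟩, ?_, ?_⟩
    · intro heq
      exact hf _ ⟨y, rfl⟩ (congrArg (fun z : Z => z.1.2) heq).symm
    · ext ⟨⟨x, t⟩, hz⟩
      have hz' : t = 0 ∨ t = f x := (mem_doubleGraph.1 hz).2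
      constructor
      · intro h
        obtain rfl : x = e y := congrArg (fun z : Z => z.1.1) h
        rcases hz' with rfl | rfl
        · exact Or.inl rfl
        · exact Or.inr rfl
      · rintro (h | h) <;>
        · obtain rfl : x = e y := congrArg (fun z : Z => z.1.1) h
          rfl

lemma isMToOneRetract_iff_hasContinuumDoubleGraph {Y X : Type} [MetricSpace Y] [MetricSpace X]
    {e : Y → X} (he : IsClosedEmbedding e) (hS : IsSubcontinuum (range e)) :
    IsMToOneRetract 2 Y ↔ HasContinuumDoubleGraph (range e) :=
  ⟨.of_isMToOneRetract he, HasContinuumDoubleGraph.isMToOneRetract he hS⟩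

lemma isCompact_graphOn {X : Type*} [TopologicalSpace X] {S : Set X} (hS : IsCompact S)
    {g : X → ℝ} (hg : Continuous g) : IsCompact ((fun x => (x, g x)) '' S) :=
  hS.image (continuous_id.prodMk hg)

lemma isPreconnected_graphOn {X : Type*} [TopologicalSpace X] {S : Set X}
    (hS : IsPreconnected S) {g : X → ℝ} (hg : Continuous g) :
    IsPreconnected ((fun x => (x, g x)) '' S) :=
  hS.image _ (continuous_id.prodMk hg).continuousOn

lemma isCompact_doubleGraph {X : Type*} [TopologicalSpace X] {S : Set X} (hS : IsCompact S)
    {g : X → ℝ} (hg : Continuous g) : IsCompact (doubleGraph S g) :=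
  (isCompact_graphOn hS continuous_const).union (isCompact_graphOn hS hg)

lemma isPreconnected_doubleGraph {X : Type*} [TopologicalSpace X] {S : Set X}
    (hS : IsPreconnected S) {g : X → ℝ} (hg : Continuous g) {s : X} (hs : s ∈ S)
    (hgs : g s = 0) : IsPreconnected (doubleGraph S g) :=
  .union (s, 0) ⟨s, hs, rfl⟩ ⟨s, hs, by simp [hgs]⟩
    (isPreconnected_graphOn hS continuous_const) (isPreconnected_graphOn hS hg)

lemma HasContinuumDoubleGraph.mono {X : Type*} [MetricSpace X] {S T : Set X}
    (hS : IsSubcontinuum S) (hT : IsSubcontinuum T) (hST : S ⊆ T)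
    (h : HasContinuumDoubleGraph S) : HasContinuumDoubleGraph T := by
  classical
  obtain ⟨f, hf, hc, hp⟩ := h
  obtain ⟨s, hs⟩ := hS.2.nonempty
  let g : X → ℝ := fun x => infDist x S
  have hg : Continuous g := continuous_infDist_pt _
  have hg0 : ∀ x, g x = 0 ↔ x ∈ S := fun x =>
    (hS.1.isClosed.mem_iff_infDist_zero hS.2.nonempty).symm
  have heq : doubleGraph T (fun x => if x ∈ S then f x else g x) =
      doubleGraph T g ∪ doubleGraph S f := by
    ext ⟨x, t⟩
    simp only [mem_union, mem_doubleGraph]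
    have := hg0 x
    have := @hST x
    by_cases hx : x ∈ S <;> simp only [hx, if_true, if_false] <;> grind
  refine ⟨fun x => if x ∈ S then f x else g x, ?_, ?_, ?_⟩
  · intro x _
    by_cases hx : x ∈ S
    · simpa [hx] using hf x hx
    · simpa [hx] using mt (hg0 x).1 hx
  · rw [heq]
    exact (isCompact_doubleGraph hT.1 hg).union hc
  · rw [heq]
    exact .union (s, 0) (Or.inl ⟨s, hST hs, rfl⟩) (Or.inl ⟨s, hs, rfl⟩)
      (isPreconnected_doubleGraph hT.2.isPreconnected hg (hST hs) ((hg0 s).2 hs)) hp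

lemma HasContinuumDoubleGraph.of_union {X : Type*} [MetricSpace X] {E F c d : Set X}
    (hE : IsSubcontinuum E) (hF : IsSubcontinuum F) (hc : IsClosed c) (hd : IsClosed d)
    (hcn : c.Nonempty) (hdn : d.Nonempty) (hcd : Disjoint c d) (hEF : E ∩ F = c ∪ d) :
    HasContinuumDoubleGraph (E ∪ F) := by
  classical
  obtain ⟨s, hs⟩ := hcn
  obtain ⟨t, ht⟩ := hdn
  have hmem : ∀ x, (x ∈ E ∧ x ∈ F) ↔ (x ∈ c ∨ x ∈ d) := fun x => Set.ext_iff.1 hEF x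
  have hdis : ∀ x, x ∈ c → x ∉ d := fun x h h' => disjoint_left.1 hcd h h'
  have hg : Continuous fun x => infDist x c := continuous_infDist_pt _
  have hh : Continuous fun x => infDist x d := continuous_infDist_pt _
  have hg0 : ∀ x, infDist x c = 0 ↔ x ∈ c := fun x => (hc.mem_iff_infDist_zero ⟨s, hs⟩).symm
  have hh0 : ∀ x, infDist x d = 0 ↔ x ∈ d := fun x => (hd.mem_iff_infDist_zero ⟨t, ht⟩).symm
  have heq : doubleGraph (E ∪ F) (fun x => if x ∈ E \ c then infDist x c else infDist x d) =
      doubleGraph E (fun x => infDist x c) ∪ doubleGraph F (fun x => infDist x d) := by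
    ext ⟨x, u⟩
    simp only [mem_union, mem_doubleGraph, mem_sdiff]
    have := hg0 x
    have := hh0 x
    have := hmem x
    have := hdis x
    by_cases hx : x ∈ E ∧ x ∉ c <;> simp only [hx, if_false] <;> grind
  have hsEF := (hmem s).2 (Or.inl hs)
  have htEF := (hmem t).2 (Or.inr ht)
  refine ⟨fun x => if x ∈ E \ c then infDist x c else infDist x d, ?_, ?_, ?_⟩
  · intro x hx
    have := hg0 x
    have := hh0 x
    have := hmem x
    have := hdis x
    simp only [mem_sdiff, mem_union] at hx ⊢
    split_ifs <;> grind
  · rw [heq]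
    exact (isCompact_doubleGraph hE.1 hg).union (isCompact_doubleGraph hF.1 hh)
  · rw [heq]
    exact .union (s, 0) (Or.inl ⟨s, hsEF.1, rfl⟩) (Or.inl ⟨s, hsEF.2, rfl⟩)
      (isPreconnected_doubleGraph hE.2.isPreconnected hg hsEF.1 ((hg0 s).2 hs))
      (isPreconnected_doubleGraph hF.2.isPreconnected hh htEF.2 ((hh0 t).2 ht))

lemma exists_closed_split_of_not_isPreconnected {Z : Type*} [TopologicalSpace Z] {K L : Set Z}
    (hK : IsClosed K) (hL : IsPreconnected L) (hLK : L ⊆ K) (h : ¬ IsPreconnected K) :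
    ∃ M N : Set Z, IsClosed M ∧ IsClosed N ∧ Disjoint M N ∧ M ∪ N = K ∧ L ⊆ M ∧ N.Nonempty := by
  rw [isPreconnected_closed_iff] at h
  push Not at h
  obtain ⟨t, t', ht, ht', hsub, hne, hne', hemp⟩ := h
  have key : ∀ t t' : Set Z, IsClosed t → IsClosed t' → K ⊆ t ∪ t' → (K ∩ t').Nonempty →
      K ∩ (t ∩ t') = ∅ → L ⊆ t →
      ∃ M N : Set Z, IsClosed M ∧ IsClosed N ∧ Disjoint M N ∧ M ∪ N = K ∧ L ⊆ M ∧
        N.Nonempty := by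
    intro t t' ht ht' hsub hne hemp hLt
    refine ⟨K ∩ t, K ∩ t', hK.inter ht, hK.inter ht', ?_, ?_, subset_inter hLK hLt, hne⟩
    · rw [disjoint_iff_inter_eq_empty, ← hemp]
      ext; simp; tauto
    · rw [← inter_union_distrib_left, inter_eq_left.2 hsub]
  have hLt : L ⊆ t ∨ L ⊆ t' := by
    rw [isPreconnected_iff_subset_of_disjoint_closed] at hL
    exact hL t t' ht ht' (hLK.trans hsub)
      (subset_eq_empty (inter_subset_inter_left _ hLK) hemp)
  rcases hLt with hLt | hLt
  · exact key t t' ht ht' hsub hne' hemp hLt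
  · exact key t' t ht' ht (by rwa [union_comm]) hne (by rwa [inter_comm t']) hLt

lemma exists_closed_split_or_subcontinuum {Z : Type*} [TopologicalSpace Z] [T2Space Z]
    {K P Q : Set Z} (hK : IsCompact K) (hP : IsClosed P) (hQ : IsClosed Q) :
    (∃ E F : Set Z, IsClosed E ∧ IsClosed F ∧ Disjoint E F ∧ E ∪ F = K ∧
      K ∩ P ⊆ E ∧ K ∩ Q ⊆ F) ∨
    ∃ k ⊆ K, IsSubcontinuum k ∧ (k ∩ P).Nonempty ∧ (k ∩ Q).Nonempty := by
  have : CompactSpace K := isCompact_iff_compactSpace.1 hK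
  let π : K → ConnectedComponents K := ConnectedComponents.mk
  have hπ : Continuous π := ConnectedComponents.continuous_coe
  let P' : Set K := Subtype.val ⁻¹' P
  let Q' : Set K := Subtype.val ⁻¹' Q
  have hclosed : ∀ T : Set Z, IsClosed T → IsClosed (π '' (Subtype.val ⁻¹' T)) := fun T hT =>
    ((hT.preimage continuous_subtype_val).isCompact.image hπ).isClosed
  by_cases hdis : Disjoint (π '' P') (π '' Q')
  · left
    obtain ⟨V, hV, hPV, hVQ⟩ := exists_clopen_of_closed_subset_open (hclosed P hP)
      (hclosed Q hQ).isOpen_compl (subset_compl_iff_disjoint_right.2 hdis)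
    have hval : ∀ T : Set K, IsClosed T → IsClosed (Subtype.val '' T) := fun T hT =>
      (hT.isCompact.image continuous_subtype_val).isClosed
    refine ⟨Subtype.val '' (π ⁻¹' V), Subtype.val '' (π ⁻¹' V)ᶜ,
      hval _ (hV.isClosed.preimage hπ), hval _ (hV.isOpen.preimage hπ).isClosed_compl,
      (disjoint_image_iff Subtype.val_injective).2 disjoint_compl_right, ?_, ?_, ?_⟩
    · rw [← image_union, union_compl_self, image_univ, Subtype.range_coe]
    · rintro z ⟨hzK, hz⟩
      exact ⟨⟨z, hzK⟩, hPV ⟨⟨z, hzK⟩, hz, rfl⟩, rfl⟩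
    · rintro z ⟨hzK, hz⟩
      exact ⟨⟨z, hzK⟩, fun h => hVQ h ⟨⟨z, hzK⟩, hz, rfl⟩, rfl⟩
  · right
    obtain ⟨_, ⟨p, hp, rfl⟩, ⟨q, hq, hpq⟩⟩ := not_disjoint_iff.1 hdis
    refine ⟨Subtype.val '' connectedComponent p, ?_,
      ⟨isClosed_connectedComponent.isCompact.image continuous_subtype_val,
        isConnected_connectedComponent.image _ continuous_subtype_val.continuousOn⟩,
      ⟨p, ⟨p, mem_connectedComponent, rfl⟩, hp⟩, ⟨q, ⟨q, ?_, rfl⟩, hq⟩⟩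
    · rintro _ ⟨z, -, rfl⟩
      exact z.2
    · exact ConnectedComponents.coe_eq_coe'.1 hpq

/-- Clopen pieces of the double graphs over `A` and `B` that miss the zero section and agree over
`A ∩ B` are empty when the double graph over `A ∪ B` is connected. -/
lemma not_nonempty_of_closed_splits {X : Type*} [TopologicalSpace X] {A B : Set X} {f : X → ℝ}
    (hp : IsPreconnected (doubleGraph (A ∪ B) f)) {M N M' N' : Set (X × ℝ)}
    (hM : IsClosed M) (hN : IsClosed N) (hM' : IsClosed M') (hN' : IsClosed N')
    (hMN : Disjoint M N) (hMN' : Disjoint M' N')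
    (hA : M ∪ N = doubleGraph A f) (hB : M' ∪ N' = doubleGraph B f)
    (hMne : M.Nonempty)
    (hagree : ∀ p : X × ℝ, p.1 ∈ A → p.1 ∈ B → (p ∈ N ↔ p ∈ N')) :
    ¬ (N ∪ N').Nonempty := by
  intro hne
  have hcover : (M ∪ M') ∪ (N ∪ N') = doubleGraph (A ∪ B) f := by
    rw [union_union_union_comm, hA, hB]
    ext p
    simp only [mem_union, mem_doubleGraph, or_and_right]
  obtain ⟨p, -, hp1, hp2⟩ := isPreconnected_closed_iff.1 hp (M ∪ M') (N ∪ N') (hM.union hM')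
    (hN.union hN') hcover.ge
    (by rw [← hcover, inter_eq_right.2 subset_union_left]; exact hMne.mono subset_union_left)
    (by rwa [← hcover, inter_eq_right.2 subset_union_right])
  have hpA : p ∈ M ∪ N → p.1 ∈ A := fun h => (mem_doubleGraph.1 (hA ▸ h)).1
  have hpB : p ∈ M' ∪ N' → p.1 ∈ B := fun h => (mem_doubleGraph.1 (hB ▸ h)).1
  rcases hp1 with h | h <;> rcases hp2 with h' | h'
  · exact disjoint_left.1 hMN h h'
  · exact disjoint_left.1 hMN h ((hagree p (hpA (Or.inl h)) (hpB (Or.inr h'))).2 h')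
  · exact disjoint_left.1 hMN' h ((hagree p (hpA (Or.inr h')) (hpB (Or.inl h))).1 h')
  · exact disjoint_left.1 hMN' h h'

lemma isCompact_doubleGraph_subset {X : Type*} [TopologicalSpace X] {S T : Set X} {f : X → ℝ}
    (hST : S ⊆ T) (hS : IsClosed S) (hT : IsCompact (doubleGraph T f)) :
    IsCompact (doubleGraph S f) := by
  have : doubleGraph S f = doubleGraph T f ∩ Prod.fst ⁻¹' S := by
    ext p
    have := @hST p.1
    simp only [mem_inter_iff, mem_preimage, mem_doubleGraph]
    tauto
  rw [this]
  exact hT.inter_right (hS.preimage continuous_fst)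

/-- If `A` has no continuum double graph, then the double graph of `f` over `A` has a clopen piece
that misses the zero section and meets the part over the subcontinuum `C` only inside `N`,
provided `N` is clopen over `C` and not empty. -/
lemma exists_closed_split_subordinate {X : Type*} [MetricSpace X] {A C : Set X} {f : X → ℝ}
    (hA : IsSubcontinuum A) (hC : IsSubcontinuum C) (hCA : C ⊆ A)
    (hf : ∀ x ∈ A, f x ≠ 0) (hc : IsCompact (doubleGraph A f))
    (hnA : ¬ HasContinuumDoubleGraph A) {M N : Set (X × ℝ)}
    (hM : IsClosed M) (hN : IsCompact N) (hMN : Disjoint M N)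
    (hMNC : M ∪ N = doubleGraph C f) (hM0 : (fun x => (x, (0 : ℝ))) '' C ⊆ M)
    (hne : N.Nonempty) :
    ∃ M' N' : Set (X × ℝ), IsClosed M' ∧ IsClosed N' ∧ Disjoint M' N' ∧
      M' ∪ N' = doubleGraph A f ∧ (fun x => (x, (0 : ℝ))) '' A ⊆ M' ∧ N'.Nonempty ∧
      ∀ p ∈ N', p.1 ∈ C → p ∈ N := by
  classical
  have hMNd : ∀ p, p ∈ M → p ∉ N := fun p h h' => disjoint_left.1 hMN h h'
  have hMNm : ∀ x t, ((x, t) ∈ M ∨ (x, t) ∈ N) ↔ x ∈ C ∧ (t = 0 ∨ t = f x) := fun x t =>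
    (Set.ext_iff.1 hMNC (x, t)).trans mem_doubleGraph
  have hM0' : ∀ x ∈ C, (x, (0 : ℝ)) ∈ M := fun x hx => hM0 ⟨x, hx, rfl⟩
  let Q : Set X := Prod.fst '' N
  have hQc : IsClosed Q := (hN.image continuous_fst).isClosed
  have hQn : Q.Nonempty := hne.image _
  have hQ : ∀ x, x ∈ Q ↔ x ∈ C ∧ (x, f x) ∈ N := by
    intro x
    constructor
    · rintro ⟨⟨x, t⟩, hp, rfl⟩
      have hx := (hMNm x t).1 (Or.inr hp)
      refine ⟨hx.1, ?_⟩
      rcases hx.2 with rfl | rfl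
      · exact absurd hp (hMNd _ (hM0' x hx.1))
      · exact hp
    · rintro ⟨-, hx⟩
      exact ⟨_, hx, rfl⟩
  obtain ⟨q, hq⟩ := hQn
  have hqC : q ∈ C := ((hQ q).1 hq).1
  have hq0 : ∀ x, infDist x Q = 0 ↔ x ∈ Q := fun x => (hQc.mem_iff_infDist_zero ⟨q, hq⟩).symm
  have hg0 : ∀ p, infDist p M = 0 ↔ p ∈ M := fun p =>
    (hM.mem_iff_infDist_zero ⟨_, hM0' q hqC⟩).symm
  have hQdist : Continuous fun x => infDist x Q := continuous_infDist_pt _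
  let Φ : X × ℝ → X × ℝ := fun p => (p.1, p.2 * infDist p M)
  have hΦ : Continuous Φ :=
    continuous_fst.prodMk (continuous_snd.mul (continuous_infDist_pt _))
  have hΦ0 : ∀ x, Φ (x, 0) = (x, 0) := fun x => by simp [Φ]
  have hΦM : ∀ p ∈ M, Φ p = (p.1, 0) := fun p hp => by simp [Φ, (hg0 p).2 hp]
  let f' : X → ℝ := fun x => if x ∈ C \ Q then infDist x Q else f x * infDist (x, f x) M
  have hfM : ∀ x ∈ C \ Q, (x, f x) ∈ M := fun x hx =>
    ((hMNm x (f x)).2 ⟨hx.1, Or.inr rfl⟩).resolve_right fun h => hx.2 ((hQ x).2 ⟨hx.1, h⟩)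
  have heq : doubleGraph A f' = Φ '' doubleGraph A f ∪ (fun x => (x, infDist x Q)) '' C := by
    ext ⟨x, t⟩
    rw [mem_doubleGraph]
    simp only
    constructor
    · rintro ⟨hx, rfl | rfl⟩
      · exact Or.inl ⟨(x, 0), mem_doubleGraph.2 ⟨hx, Or.inl rfl⟩, hΦ0 x⟩
      · by_cases hxC : x ∈ C \ Q
        · exact Or.inr ⟨x, hxC.1, by simp only [f', if_pos hxC]⟩
        · exact Or.inl ⟨(x, f x), mem_doubleGraph.2 ⟨hx, Or.inr rfl⟩,
            by simp only [f', if_neg hxC, Φ]⟩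
    · rintro (⟨⟨y, u⟩, hy, hyx⟩ | ⟨y, hy, hyx⟩)
      · obtain rfl : y = x := congrArg Prod.fst hyx
        obtain rfl : u * infDist (y, u) M = t := congrArg Prod.snd hyx
        obtain ⟨hyA, hu⟩ := mem_doubleGraph.1 hy
        refine ⟨hyA, ?_⟩
        rcases hu with hu | hu
        · exact Or.inl (by simp only at hu; simp [hu])
        · simp only at hu
          subst hu
          by_cases hxC : y ∈ C \ Q
          · exact Or.inl (by simp [(hg0 _).2 (hfM y hxC)])
          · exact Or.inr (by simp only [f', if_neg hxC])
      · obtain rfl : y = x := congrArg Prod.fst hyx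
        obtain rfl : infDist y Q = t := congrArg Prod.snd hyx
        refine ⟨hCA hy, ?_⟩
        by_cases hyQ : y ∈ Q
        · exact Or.inl ((hq0 y).2 hyQ)
        · exact Or.inr (by simp only [f', if_pos (show y ∈ C \ Q from ⟨hy, hyQ⟩)])
  have hf' : ∀ x ∈ A, f' x ≠ 0 := by
    intro x hx
    by_cases hxC : x ∈ C \ Q
    · simp only [f', if_pos hxC]
      exact mt (hq0 x).1 hxC.2
    · simp only [f', if_neg hxC]
      refine mul_ne_zero (hf x hx) (mt (hg0 _).1 fun h => hxC ?_)
      exact ⟨((hMNm _ _).1 (Or.inl h)).1, fun h' => hMNd _ h ((hQ x).1 h').2⟩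
  have hcomp : IsCompact (doubleGraph A f') :=
    heq ▸ (hc.image hΦ).union (isCompact_graphOn hC.1 hQdist)
  have hL : IsPreconnected
      ((fun x => (x, (0 : ℝ))) '' A ∪ (fun x => (x, infDist x Q)) '' C) :=
    .union (q, 0) ⟨q, hCA hqC, rfl⟩ ⟨q, hqC, by simp [(hq0 q).2 hq]⟩
      (isPreconnected_graphOn hA.2.isPreconnected continuous_const)
      (isPreconnected_graphOn hC.2.isPreconnected hQdist)
  obtain ⟨M₁, N₁, hM₁, hN₁, hd₁, hu₁, hL₁, hn₁⟩ := exists_closed_split_of_not_isPreconnected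
    hcomp.isClosed hL (union_subset subset_union_left (heq ▸ subset_union_right))
    (fun h => hnA ⟨f', hf', hcomp, h⟩)
  have hzero : ∀ x ∈ A, (x, (0 : ℝ)) ∈ M₁ := fun x hx => hL₁ (Or.inl ⟨x, hx, rfl⟩)
  have hdcl : IsClosed (doubleGraph A f) := hc.isClosed
  refine ⟨doubleGraph A f ∩ Φ ⁻¹' M₁, doubleGraph A f ∩ Φ ⁻¹' N₁,
    hdcl.inter (hM₁.preimage hΦ), hdcl.inter (hN₁.preimage hΦ),
    (hd₁.preimage Φ).mono inter_subset_right inter_subset_right, ?_, ?_, ?_, ?_⟩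
  · rw [← inter_union_distrib_left, ← preimage_union, hu₁, inter_eq_left, heq]
    exact fun p hp => Or.inl ⟨p, hp, rfl⟩
  · rintro _ ⟨x, hx, rfl⟩
    exact ⟨Or.inl ⟨x, hx, rfl⟩, by rw [mem_preimage, hΦ0]; exact hzero x hx⟩
  · obtain ⟨z, hz⟩ := hn₁
    have hz' : z ∈ doubleGraph A f' := hu₁ ▸ Or.inr hz
    rw [heq] at hz'
    rcases hz' with ⟨p, hp, rfl⟩ | hz'
    · exact ⟨p, hp, hz⟩
    · exact absurd hz (disjoint_left.1 hd₁ (hL₁ (Or.inr hz')))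
  · rintro ⟨x, t⟩ ⟨hp, hpN⟩ hxC
    refine ((hMNm x t).2 ⟨hxC, (mem_doubleGraph.1 hp).2⟩).resolve_left fun hpM => ?_
    rw [mem_preimage, hΦM _ hpM] at hpN
    exact disjoint_left.1 hd₁ (hzero x (hCA hxC)) hpN

lemma HasContinuumDoubleGraph.of_inter_isConnected {X : Type*} [MetricSpace X] {A B : Set X}
    (hA : IsSubcontinuum A) (hB : IsSubcontinuum B) (hC : IsConnected (A ∩ B))
    (h : HasContinuumDoubleGraph (A ∪ B)) :
    HasContinuumDoubleGraph A ∨ HasContinuumDoubleGraph B := by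
  by_contra hno
  obtain ⟨hnA, hnB⟩ := not_or.1 hno
  obtain ⟨f, hf, hc, hp⟩ := h
  have hC' : IsSubcontinuum (A ∩ B) := ⟨hA.1.inter hB.1, hC⟩
  have hclC : IsClosed ((Prod.fst : X × ℝ → X) ⁻¹' (A ∩ B)) :=
    hC'.1.isClosed.preimage continuous_fst
  have hcA := isCompact_doubleGraph_subset subset_union_left hA.1.isClosed hc
  have hcB := isCompact_doubleGraph_subset subset_union_right hB.1.isClosed hc
  obtain ⟨M, N, hM, hN, hMN, hu, hM0, hne⟩ := exists_closed_split_of_not_isPreconnected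
    hcB.isClosed (isPreconnected_graphOn hB.2.isPreconnected continuous_const) subset_union_left
    (fun h => hnB ⟨f, fun x hx => hf x (Or.inr hx), hcB, h⟩)
  have hNB : N ⊆ doubleGraph B f := hu ▸ subset_union_right
  have hNf : ∀ p ∈ N, p.2 = f p.1 := by
    intro p hp
    obtain ⟨hpB, hp2⟩ := mem_doubleGraph.1 (hNB hp)
    refine hp2.resolve_left fun h => disjoint_left.1 hMN (hM0 ⟨p.1, hpB, ?_⟩) hp
    exact Prod.ext rfl h.symm
  have hNc : IsCompact N := hcB.of_isClosed_subset hN hNB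
  rcases (N ∩ Prod.fst ⁻¹' (A ∩ B)).eq_empty_or_nonempty with hemp | hNC
  · refine not_nonempty_of_closed_splits hp hcA.isClosed isClosed_empty hM hN
      (disjoint_empty _) hMN (union_empty _) hu
      (hA.2.nonempty.image _ |>.mono subset_union_left) ?_ (hne.mono subset_union_right)
    intro p hpA hpB
    exact iff_of_false (notMem_empty p) fun h =>
      (eq_empty_iff_forall_notMem.1 hemp p) ⟨h, hpA, hpB⟩
  obtain ⟨M', N', hM', hN', hMN', hu', hM0', hne', hsub⟩ :=
    exists_closed_split_subordinate hA hC' inter_subset_left (fun x hx => hf x (Or.inl hx)) hcA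
      hnA (hM.inter hclC) (hNc.inter_right hclC)
      (hMN.mono inter_subset_left inter_subset_left)
      (by
        rw [← union_inter_distrib_right, hu]
        ext p
        simp only [mem_inter_iff, mem_preimage, mem_doubleGraph]
        tauto)
      (by
        rintro _ ⟨x, hx, rfl⟩
        exact ⟨hM0 ⟨x, hx.2, rfl⟩, hx⟩) hNC
  have hcover : ∀ p ∈ N, p.1 ∈ A → p ∈ M' ∪ N' := fun p hp hpA => by
    rw [hu', mem_doubleGraph]
    exact ⟨hpA, Or.inr (hNf p hp)⟩
  rcases exists_closed_split_or_subcontinuum hNc (hN'.inter hclC) (hM'.inter hclC) with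
    ⟨E, F, hE, hF, hEF, hEFN, hPE, hQF⟩ | ⟨k, hkN, hk, hkP, hkQ⟩
  · have hEN : E ⊆ N := hEFN ▸ subset_union_left
    refine not_nonempty_of_closed_splits hp hM' hN' (hM.union hF) hE hMN'
      (disjoint_union_left.2 ⟨hMN.mono_right hEN, hEF.symm⟩) hu'
      (by rw [union_assoc, union_comm F, hEFN, hu])
      ((hA.2.nonempty.image _).mono hM0') ?_ (hne'.mono subset_union_left)
    intro p hpA hpB
    refine ⟨fun h => hPE ⟨(hsub p h ⟨hpA, hpB⟩).1, h, hpA, hpB⟩, fun h => ?_⟩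
    refine (hcover p (hEN h) hpA).resolve_left fun h' => ?_
    exact disjoint_left.1 hEF h (hQF ⟨hEN h, h', hpA, hpB⟩)
  · have hk' : IsSubcontinuum (Prod.fst '' k) :=
      ⟨hk.1.image continuous_fst, hk.2.image _ continuous_fst.continuousOn⟩
    have hcl : ∀ T : Set (X × ℝ), IsClosed T → IsClosed (Prod.fst '' (k ∩ T)) := fun T hT =>
      ((hk.1.inter_right hT).image continuous_fst).isClosed
    have hinj : InjOn Prod.fst k := fun p hp q hq hpq =>
      Prod.ext hpq (by rw [hNf p (hkN hp), hNf q (hkN hq), hpq])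
    have hkB : Prod.fst '' k ⊆ B := by
      rintro _ ⟨p, hp, rfl⟩
      exact (mem_doubleGraph.1 (hNB (hkN hp))).1
    have hunion : Prod.fst '' k ∩ (A ∩ B) =
        Prod.fst '' (k ∩ (N' ∩ Prod.fst ⁻¹' (A ∩ B))) ∪
          Prod.fst '' (k ∩ (M' ∩ Prod.fst ⁻¹' (A ∩ B))) := by
      rw [← image_union, ← inter_union_distrib_left, ← union_inter_distrib_right,
        ← image_inter_preimage]
      congr 1
      ext p
      constructor
      · rintro ⟨hp, hpC⟩
        exact ⟨hp, union_comm M' N' ▸ hcover p (hkN hp) hpC.1, hpC⟩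
      · rintro ⟨hp, -, hpC⟩
        exact ⟨hp, hpC⟩
    have hdouble := HasContinuumDoubleGraph.of_union hk' hC' (hcl _ (hN'.inter hclC))
      (hcl _ (hM'.inter hclC)) (hkP.image _) (hkQ.image _) (by
        rw [disjoint_left]
        rintro _ ⟨p, hp, rfl⟩ ⟨q, hq, hqp⟩
        exact disjoint_left.1 hMN' hq.2.1 (hinj hp.1 hq.1 hqp.symm ▸ hp.2.1)) hunion
    obtain ⟨p, hpk, -, hpC⟩ := hkP
    exact hnB (hdouble.mono ⟨hk'.1.union hC'.1, hk'.2.union ⟨p.1, ⟨p, hpk, rfl⟩, hpC⟩ hC⟩ hB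
      (union_subset hkB inter_subset_right))

/-- Suppose `X = A ∪ B` is a decomposable continuum with `A` and `B` proper subcontinua.
Then `X` is a 2-to-1 retract iff `A` is a 2-to-1 retract, or `B` is a 2-to-1 retract,
or `A ∩ B` is not connected. -/
theorem decomposable_two_to_one_retract_iff
    (X : Type) [MetricSpace X] [CompactSpace X] [ConnectedSpace X] [Nonempty X]
    (A B : Set X) (hA : IsSubcontinuum A) (hAp : A ≠ Set.univ)
    (hB : IsSubcontinuum B) (hBp : B ≠ Set.univ) (hAB : A ∪ B = Set.univ) :
    IsMToOneRetract 2 X ↔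
      (IsMToOneRetract 2 ↥A ∨ IsMToOneRetract 2 ↥B ∨ ¬ IsConnected (A ∩ B)) := by
  have hX : IsSubcontinuum (univ : Set X) := ⟨isCompact_univ, isConnected_univ⟩
  have hsub : ∀ S : Set X, IsSubcontinuum S →
      (IsMToOneRetract 2 ↥S ↔ HasContinuumDoubleGraph S) := fun S hS => by
    simpa using isMToOneRetract_iff_hasContinuumDoubleGraph
      hS.1.isClosed.isClosedEmbedding_subtypeVal (by simpa using hS)
  have huniv : IsMToOneRetract 2 X ↔ HasContinuumDoubleGraph (univ : Set X) := by
    simpa using isMToOneRetract_iff_hasContinuumDoubleGraph (IsClosedEmbedding.id (X := X))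
      (by simpa using hX)
  rw [hsub A hA, hsub B hB, huniv]
  constructor
  · intro h
    by_cases hC : IsConnected (A ∩ B)
    · rw [← hAB] at h
      have := h.of_inter_isConnected hA hB hC
      tauto
    · tauto
  · rintro (h | h | h)
    · exact h.mono hA hX (subset_univ _)
    · exact h.mono hB hX (subset_univ _)
    · have hAc := hA.1.isClosed
      have hBc := hB.1.isClosed
      have hne : (A ∩ B).Nonempty := by
        have := isPreconnected_closed_iff.1 (isPreconnected_univ (α := X)) A B hAc hBc
          hAB.ge (by simpa using hA.2.nonempty) (by simpa using hB.2.nonempty)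
        simpa using this
      obtain ⟨c, d, hc, hd, hcd, hu, hcn, hdn⟩ := exists_closed_split_of_not_isPreconnected
        (L := {hne.some}) (hAc.inter hBc) isPreconnected_singleton
        (singleton_subset_iff.2 hne.some_mem) (fun h' => h ⟨hne, h'⟩)
      rw [← hAB]
      exact .of_union hA hB hc hd ⟨_, hcn rfl⟩ hdn hcd hu.symm
end

section
/- Suppose the continuum Y is a k-to-1 retract of a continuum for some integer k ≥ 2. Then for each positive integer n, Y is a (1 + (k-1)·n)-to-1 retract of a continuum. -/
open Set Metric Topology

/-- The `i`-th copy of `x` in the space obtained by gluing copies of `X` along the image of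
the retraction `r`, realized inside the product of the copies. -/
def glueCopy {ι X : Type*} [DecidableEq ι] (r : X → X) (i : ι) (x : X) : ι → X :=
  Function.update (fun _ => r x) i x

section GlueCopy

variable {ι X : Type*} [DecidableEq ι] {r : X → X}

theorem continuous_glueCopy [TopologicalSpace X] (hr : Continuous r) (i : ι) :
    Continuous (glueCopy r i) :=
  (continuous_pi fun _ => hr).update i continuous_id

theorem glueCopy_of_fixed (i : ι) {y : X} (hy : r y = y) : glueCopy r i y = fun _ => y := by
  simp [glueCopy, hy]

theorem apply_glueCopy (hr : ∀ x, r (r x) = r x) (i j : ι) (x : X) :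
    r (glueCopy r i x j) = r x := by
  by_cases h : j = i
  · subst h; simp [glueCopy]
  · simp [glueCopy, h, hr]

theorem ncard_fiber_iUnion_range_glueCopy [Fintype ι] (i₀ : ι) (hr : ∀ x, r (r x) = r x) {y : X}
    (hy : r y = y) (hfin : {x | r x = y}.Finite) :
    {p ∈ ⋃ i, range (glueCopy r i) | r (p i₀) = y}.ncard =
      1 + ({x | r x = y}.ncard - 1) * Fintype.card ι := by
  have key : {p ∈ ⋃ i, range (glueCopy r i) | r (p i₀) = y} =
      insert (fun _ => y) ((fun q : ι × X => glueCopy r q.1 q.2) ''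
        (univ ×ˢ ({x | r x = y} \ {y}))) := by
    ext p
    simp only [mem_ofPred_eq, mem_iUnion, mem_range, mem_insert_iff, mem_image, mem_prod, mem_univ,
      true_and, mem_sdiff, mem_singleton_iff, Prod.exists]
    constructor
    · rintro ⟨⟨i, x, rfl⟩, h⟩
      rw [apply_glueCopy hr] at h
      by_cases hx : x = y
      · left; rw [hx, glueCopy_of_fixed i hy]
      · exact Or.inr ⟨i, x, ⟨h, hx⟩, rfl⟩
    · rintro (rfl | ⟨i, x, ⟨h, -⟩, rfl⟩)
      · exact ⟨⟨i₀, y, glueCopy_of_fixed i₀ hy⟩, hy⟩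
      · exact ⟨⟨i, x, rfl⟩, by rw [apply_glueCopy hr, h]⟩
  have hfin' : ((univ : Set ι) ×ˢ ({x | r x = y} \ {y})).Finite :=
    finite_univ.prod hfin.sdiff
  rw [key, ncard_insert_of_notMem _ (hfin'.image _), InjOn.ncard_image, ncard_prod,
    ncard_univ, Nat.card_eq_fintype_card, ncard_sdiff_singleton_of_mem (s := {x | r x = y}) hy]
  · ring
  · rintro ⟨i, x⟩ ⟨-, hx, hxy⟩ ⟨j, z⟩ ⟨-, hz, hzy⟩ h
    simp only [mem_ofPred_eq, mem_singleton_iff] at hx hxy hz hzy h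
    have hi := congrFun h i
    by_cases hij : i = j
    · subst hij
      simpa [glueCopy] using hi
    · simp [glueCopy, hij, hz, hxy] at hi
  · rintro ⟨⟨i, x⟩, ⟨-, -, hxy⟩, h⟩
    exact hxy (by simpa [glueCopy] using congrFun h i)

end GlueCopy

/-- If the continuum `Y` is a `k`-to-1 retract of a continuum (`k ≥ 2`), then for each
positive integer `n`, `Y` is a `(1 + (k-1)·n)`-to-1 retract of a continuum. -/
theorem kToOneRetract_implies_one_add_mul_retract
    (Y : Type) [MetricSpace Y] [CompactSpace Y] [ConnectedSpace Y] [Nonempty Y]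
    (k : ℕ) (hk : 2 ≤ k) (hY : IsMToOneRetract k Y) (n : ℕ) (hn : 1 ≤ n) :
    IsMToOneRetract (1 + (k - 1) * n) Y := by
  obtain ⟨X, _, _, _, _, Y', hY', ⟨e⟩, r, hr, hrY, hfix, hcard⟩ := hY
  have hrr : ∀ x, r (r x) = r x := fun x => hfix _ (hrY x)
  obtain ⟨y₀, hy₀⟩ := hY'.2.1
  let i₀ : Fin n := ⟨0, hn⟩
  let S : Set (Fin n → X) := ⋃ i, range (glueCopy r i)
  have hdiag : ∀ y ∈ Y', (fun _ => y) ∈ S := fun y hy =>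
    mem_iUnion.2 ⟨i₀, y, glueCopy_of_fixed i₀ (hfix y hy)⟩
  have hScomp : IsCompact S :=
    isCompact_iUnion fun i => isCompact_range (continuous_glueCopy hr i)
  have hSconn : IsConnected S :=
    ⟨⟨_, hdiag y₀ hy₀⟩, isPreconnected_iUnion
      ⟨fun _ => y₀, mem_iInter.2 fun i => ⟨y₀, glueCopy_of_fixed i (hfix y₀ hy₀)⟩⟩
      fun i => isPreconnected_range (continuous_glueCopy hr i)⟩
  have : CompactSpace Y' := isCompact_iff_compactSpace.1 hY'.1
  have : ConnectedSpace Y' := isConnected_iff_connectedSpace.1 hY'.2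
  let h : Y' → S := fun y => ⟨fun _ => y, hdiag y y.2⟩
  have hcont : Continuous h := by
    exact (continuous_pi fun _ => continuous_subtype_val).subtype_mk _
  have hinj : Function.Injective h := fun a b hab =>
    Subtype.ext (congrFun (congrArg Subtype.val hab) i₀)
  let R : S → S := fun p => h ⟨r (p.1 i₀), hrY _⟩
  refine ⟨S, inferInstance, isCompact_iff_compactSpace.1 hScomp,
    isConnected_iff_connectedSpace.1 hSconn, hSconn.1.to_subtype, range h,
    ⟨isCompact_range hcont, isConnected_range hcont⟩,
    ⟨e.trans (hcont.isClosedEmbedding hinj).isEmbedding.toHomeomorph⟩, R, ?_,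
    fun p => mem_range_self _, ?_, ?_⟩
  · exact hcont.comp
      ((hr.comp ((continuous_apply i₀).comp continuous_subtype_val)).subtype_mk _)
  · rintro _ ⟨y, rfl⟩
    exact congrArg h (Subtype.ext (hfix y y.2))
  · rintro _ ⟨y, rfl⟩
    have himage : Subtype.val '' {p : S | R p = h y} = {p ∈ S | r (p i₀) = y} := by
      ext p
      simp [R, hinj.eq_iff, Subtype.ext_iff, and_comm]
    have hfin : {x | r x = y}.Finite :=
      finite_of_ncard_ne_zero (by rw [hcard y y.2]; omega)
    rw [← ncard_image_of_injective _ Subtype.val_injective, himage,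
      ncard_fiber_iUnion_range_glueCopy i₀ hrr (hfix y y.2) hfin, hcard y y.2, Fintype.card_fin]
end

section
/- If a continuum Y is a 2-to-1 retract of a continuum, then Y is a k-to-1 retract of a continuum for every integer k > 2. -/
open Set Metric Topology

/-- The union of the graphs of `j • infDist · A` for `j ≤ n`: a metric model of `n + 1` copies of `X`
glued along the closed set `A`. -/
def gluedCopies {X : Type*} [MetricSpace X] (A : Set X) (n : ℕ) : Set (X × ℝ) :=
  ⋃ j : Fin (n + 1), Set.range fun x : X => (x, (j : ℝ) * infDist x A)

section gluedCopies

variable {X : Type*} [MetricSpace X] {A : Set X} {n : ℕ}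

theorem mem_gluedCopies {p : X × ℝ} :
    p ∈ gluedCopies A n ↔ ∃ j : Fin (n + 1), p.2 = (j : ℝ) * infDist p.1 A := by
  simp only [gluedCopies, Set.mem_iUnion, Set.mem_range]
  constructor
  · rintro ⟨j, x, rfl⟩
    exact ⟨j, rfl⟩
  · rintro ⟨j, hj⟩
    exact ⟨j, p.1, Prod.ext rfl hj.symm⟩

theorem mk_zero_mem_gluedCopies (x : X) : (x, (0 : ℝ)) ∈ gluedCopies A n :=
  mem_gluedCopies.2 ⟨0, by simp⟩

theorem continuous_graph_mul_infDist (c : ℝ) :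
    Continuous fun x : X => (x, c * infDist x A) :=
  continuous_id.prodMk (continuous_const.mul (continuous_infDist_pt A))

theorem isCompact_gluedCopies [CompactSpace X] : IsCompact (gluedCopies A n) :=
  isCompact_iUnion fun _ => isCompact_range (continuous_graph_mul_infDist _)

theorem isConnected_gluedCopies [ConnectedSpace X] (hA : A.Nonempty) :
    IsConnected (gluedCopies A n) := by
  obtain ⟨a, ha⟩ := hA
  refine ⟨⟨(a, 0), mk_zero_mem_gluedCopies a⟩, ?_⟩
  refine isPreconnected_iUnion
    ⟨(a, 0), Set.mem_iInter.2 fun j => ⟨a, by simp [infDist_zero_of_mem ha]⟩⟩ fun j => isPreconnected_range (continuous_graph_mul_infDist _)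

theorem ncard_fiber_gluedCopies {r : X → X} {y : X} (hA : IsClosed A) (hy : y ∈ A)
    (hr : ∀ a ∈ A, r a = a) (h : {x : X | r x = y}.ncard = 2) :
    {p : X × ℝ | p ∈ gluedCopies A n ∧ r p.1 = y}.ncard = n + 2 := by
  obtain ⟨z, hz, hzy⟩ := Set.exists_ne_of_one_lt_ncard (by omega : 1 < {x : X | r x = y}.ncard) y
  have hfib : {x : X | r x = y} = {y, z} := by
    refine (Set.eq_of_subset_of_ncard_le ?_ ?_ (Set.finite_of_ncard_ne_zero (by omega))).symm
    · rintro x (rfl | rfl)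
      exacts [hr _ hy, hz]
    · rw [h, Set.ncard_pair hzy.symm]
  have hzA : z ∉ A := fun hmem => hzy ((hr z hmem).symm.trans hz)
  have hpos : 0 < infDist z A := (hA.notMem_iff_infDist_pos ⟨y, hy⟩).1 hzA
  have hset : {p : X × ℝ | p ∈ gluedCopies A n ∧ r p.1 = y} =
      insert (y, 0) (Set.range fun j : Fin (n + 1) => (z, (j : ℝ) * infDist z A)) := by
    ext ⟨x, t⟩
    simp only [Set.mem_ofPred_eq, mem_gluedCopies, Set.mem_insert_iff, Set.mem_range, Prod.mk.injEq]
    constructor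
    · rintro ⟨⟨j, hj⟩, hx⟩
      have hx' : x ∈ ({y, z} : Set X) := hfib ▸ hx
      rcases hx' with rfl | rfl
      · exact Or.inl ⟨rfl, by rw [hj, infDist_zero_of_mem hy, mul_zero]⟩
      · exact Or.inr ⟨j, rfl, hj.symm⟩
    · rintro (⟨rfl, rfl⟩ | ⟨j, rfl, rfl⟩)
      · exact ⟨⟨0, by simp⟩, hr _ hy⟩
      · exact ⟨⟨j, rfl⟩, hz⟩
  have hinj : Function.Injective fun j : Fin (n + 1) => (z, (j : ℝ) * infDist z A) := by
    intro i j hij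
    have := mul_right_cancel₀ hpos.ne' (Prod.ext_iff.1 hij).2
    exact Fin.ext (by exact_mod_cast this)
  have hnot : (y, (0 : ℝ)) ∉ Set.range fun j : Fin (n + 1) => (z, (j : ℝ) * infDist z A) := by
    rintro ⟨j, hj⟩
    exact hzy (Prod.ext_iff.1 hj).1
  rw [hset, Set.ncard_insert_of_notMem hnot (Set.finite_range _), ← Set.image_univ,
    Set.ncard_image_of_injective _ hinj, Set.ncard_univ, Nat.card_fin]

end gluedCopies

/-- If a continuum `Y` is a 2-to-1 retract of a continuum, then `Y` is a `k`-to-1 retract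
of a continuum for each `k > 2`. -/
theorem two_to_one_retract_implies_k_to_one_retract
    (Y : Type) [MetricSpace Y] [CompactSpace Y] [ConnectedSpace Y] [Nonempty Y]
    (hY : IsMToOneRetract 2 Y) (k : ℕ) (hk : 2 < k) :
    IsMToOneRetract k Y := by
  obtain ⟨n, rfl⟩ : ∃ n, k = n + 2 := ⟨k - 2, by omega⟩
  obtain ⟨X, _, _, _, _, A, ⟨hAc, hAconn⟩, ⟨e⟩, r, hrc, hrA, hr, hfib⟩ := hY
  have hS : IsConnected (gluedCopies A n) := isConnected_gluedCopies hAconn.nonempty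
  let i : X → gluedCopies A n := fun x => ⟨(x, 0), mk_zero_mem_gluedCopies x⟩
  have hi : Continuous i := by fun_prop
  have hiA : IsEmbedding fun y : Y => i (e y) :=
    (IsEmbedding.of_leftInverse (f := fun p : gluedCopies A n => p.1.1) (fun _ => rfl)
      (by fun_prop) hi).comp (IsEmbedding.subtypeVal.comp e.isEmbedding)
  have hmem : ∀ x ∈ A, i x ∈ Set.range fun y : Y => i (e y) :=
    fun x hx => ⟨e.symm ⟨x, hx⟩, by simp⟩
  refine ⟨gluedCopies A n, inferInstance, isCompact_iff_compactSpace.1 isCompact_gluedCopies,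
    isConnected_iff_connectedSpace.1 hS, hS.nonempty.to_subtype, Set.range fun y : Y => i (e y),
    ⟨isCompact_range hiA.continuous, isConnected_range hiA.continuous⟩, ⟨hiA.toHomeomorph⟩,
    fun p => i (r p.1.1), by fun_prop, fun p => hmem _ (hrA _), ?_, ?_⟩
  · rintro _ ⟨y, rfl⟩
    exact congrArg i (hr _ (e y).2)
  · rintro _ ⟨y, rfl⟩
    rw [← ncard_fiber_gluedCopies (n := n) hAc.isClosed (e y).2 hr (hfib _ (e y).2),
      ← Set.ncard_image_of_injective _ Subtype.val_injective]
    congr 1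
    ext p
    simp [i, and_comm]
end
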